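/- Let Q be a commutative Noetherian ring of finite Krull dimension, let f_1,…,f_c be a regular sequence in Q, and set A = Q/(f_1,…,f_c). Let M be a finitely generated A-module whose projective dimension over Q (via the quotient map Q → A) is finite. Let I be an ideal of A and D a finitely generated A-module. Then there exist i_0, n_0 such that for all i ≥ i_0 and n ≥ n_0 one has Ass_A Ext^{2i}_A(M, I^n D) = Ass_A Ext^{2i_0}_A(M, I^{n_0} D) and Ass_A Ext^{2i+1}_A(M, I^n D) = Ass_A Ext^{2i_0+1}_A(M, I^{n_0} D). -/

import Mathlib

open CategoryTheory

/-- The `i`-th Ext module `Ext^i_A(M, N)` of `A`-modules, as a type. -/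
noncomputable abbrev extAP (A : Type) [CommRing A] (M N : Type) [AddCommGroup M] [Module A M]
    [AddCommGroup N] [Module A N] (i : ℕ) : Type :=
  ((Ext A (ModuleCat A) i).obj (Opposite.op (ModuleCat.of A M))).obj (ModuleCat.of A N)


-- Part 1


set_option linter.unusedSimpArgs false
set_option linter.unusedRCasesPattern false

structure DGm {Q : Type} [CommRing Q] (f : ℕ → Q) (c : ℕ) where
  X : Type
  [ag : AddCommGroup X]
  [mod : Module Q X]
  gr : ℤ → Submodule Q X
  d : X →ₗ[Q] X
  σ : ℕ → X →ₗ[Q] X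
  d_mem : ∀ n x, x ∈ gr n → d x ∈ gr (n - 1)
  σ_mem : ∀ k < c, ∀ n x, x ∈ gr n → σ k x ∈ gr (n + 1)
  neg : ∀ n < 0, gr n = ⊥
  bdd : ∃ B : ℤ, ∀ n > B, gr n = ⊥
  fg : ∀ n, (gr n).FG
  dd : ∀ x, d (d x) = 0
  dσ : ∀ k < c, ∀ x, d (σ k x) + σ k (d x) = f k • x
  σσ : ∀ k < c, ∀ l < c, ∀ x, σ k (σ l x) + σ l (σ k x) = 0
  σsq : ∀ k < c, ∀ x, σ k (σ k x) = 0

attribute [instance] DGm.ag DGm.mod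

namespace DGm

variable {Q : Type} [CommRing Q] {f : ℕ → Q} {c : ℕ}

/-- homomorphism of dg modules -/
structure IsHom (P Y : DGm f c) (φ : P.X →ₗ[Q] Y.X) : Prop where
  d : ∀ x, φ (P.d x) = Y.d (φ x)
  σ : ∀ k < c, ∀ x, φ (P.σ k x) = Y.σ k (φ x)
  mem : ∀ n x, x ∈ P.gr n → φ x ∈ Y.gr n

/-- degreewise surjective -/
def Surj (P Y : DGm f c) (φ : P.X →ₗ[Q] Y.X) : Prop :=
  ∀ n, ∀ y ∈ Y.gr n, ∃ x ∈ P.gr n, φ x = y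

def Proj (P : DGm f c) : Prop := ∀ n, Module.Projective Q (P.gr n)

def prodEq {X Y : Type} [AddCommGroup X] [Module Q X] [AddCommGroup Y] [Module Q Y]
    (p : Submodule Q X) (q : Submodule Q Y) : (p.prod q) ≃ₗ[Q] p × q where
  toFun x := (⟨x.1.1, x.2.1⟩, ⟨x.1.2, x.2.2⟩)
  invFun x := ⟨(x.1.1, x.2.1), ⟨x.1.2, x.2.2⟩⟩
  map_add' _ _ := rfl
  map_smul' _ _ := rfl
  left_inv _ := rfl
  right_inv _ := rfl

lemma proj_prod {X Y : Type} [AddCommGroup X] [Module Q X] [AddCommGroup Y] [Module Q Y]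
    (p : Submodule Q X) (q : Submodule Q Y) (hp : Module.Projective Q p)
    (hq : Module.Projective Q q) : Module.Projective Q (p.prod q) :=
  Module.Projective.of_equiv (prodEq p q).symm

/-- forget one of the operators -/
def forget (Y : DGm f (c + 1)) : DGm f c where
  X := Y.X
  gr := Y.gr
  d := Y.d
  σ := Y.σ
  d_mem := Y.d_mem
  σ_mem k hk := Y.σ_mem k (by omega)
  neg := Y.neg
  bdd := Y.bdd
  fg := Y.fg
  dd := Y.dd
  dσ k hk := Y.dσ k (by omega)
  σσ k hk l hl := Y.σσ k (by omega) l (by omega)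
  σsq k hk := Y.σsq k (by omega)

/-- adjoin the next exterior variable -/
noncomputable def adj (V : DGm f c) : DGm f (c + 1) where
  X := V.X × V.X
  gr n := (V.gr n).prod (V.gr (n - 1))
  d := LinearMap.prod (V.d.coprod (f c • LinearMap.id)) ((0 : V.X →ₗ[Q] V.X).coprod (-V.d))
  σ k := if k = c then LinearMap.prod 0 (LinearMap.fst Q _ _) else
    LinearMap.prodMap (V.σ k) (- V.σ k)
  d_mem n x hx := by
    obtain ⟨h1, h2⟩ := hx
    refine ⟨?_, ?_⟩
    · simpa using add_mem (V.d_mem n _ h1) (Submodule.smul_mem _ (f c) h2)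
    · simpa using V.d_mem (n-1) _ h2
  σ_mem k hk n x hx := by
    obtain ⟨h1, h2⟩ := hx
    split_ifs with h
    · refine ⟨by simp, by simpa using h1⟩
    · refine ⟨by simpa using V.σ_mem k (by omega) n _ h1, ?_⟩
      have := V.σ_mem k (by omega) (n-1) _ h2
      simp only [LinearMap.prodMap_apply, LinearMap.neg_apply]
      rw [show n + 1 - 1 = n - 1 + 1 by ring]
      exact neg_mem this
  neg n hn := by
    rw [V.neg n hn, V.neg (n-1) (by omega)]; simp
  bdd := by
    obtain ⟨B, hB⟩ := V.bdd
    refine ⟨B + 1, fun n hn => ?_⟩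
    rw [hB n (by omega), hB (n-1) (by omega)]; simp
  fg n := (V.fg n).prod (V.fg (n-1))
  dd x := by
    ext
    · simp [V.dd]
    · simp [V.dd]
  dσ k hk x := by
    split_ifs with h
    · subst h; ext <;> simp
    · have h1 := V.dσ k (by omega) x.1
      have h2 := V.dσ k (by omega) x.2
      ext
      · change V.d (V.σ k x.1) + f c • (-V.σ k x.2) + V.σ k (V.d x.1 + f c • x.2) = f k • x.1
        rw [← h1, map_add, map_smul, smul_neg]
        abel
      · simp [← h2]
  σσ k hk l hl x := by
    by_cases h : k = c <;> by_cases h' : l = c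
    · simp [h, h']
    · simp [h, h']
    · simp [h, h']
    · have h1 := V.σσ k (by omega) l (by omega) x.1
      have h2 := V.σσ k (by omega) l (by omega) x.2
      ext <;> simp [h, h', h1, h2]
  σsq k hk x := by
    split_ifs with h
    · simp
    · have h1 := V.σsq k (by omega)
      ext <;> simp [h1]

lemma adj_hom (V : DGm f c) (Y : DGm f (c + 1)) (ψ : V.X →ₗ[Q] Y.X) (h : IsHom V Y.forget ψ) :
    IsHom V.adj Y (ψ.coprod (Y.σ c ∘ₗ ψ)) where
  d x := by
    have h1 := Y.dσ c (by omega) (ψ x.2)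
    have h2 := h.d
    change ∀ x, ψ (V.d x) = Y.d (ψ x) at h2
    change ψ (V.d x.1 + f c • x.2) + Y.σ c (ψ ((0 : V.X →ₗ[Q] V.X) x.1 + - V.d x.2)) = Y.d (ψ x.1 + Y.σ c (ψ x.2))
    rw [LinearMap.zero_apply, zero_add, map_neg, map_add, map_add, map_smul, map_neg, h2, h2, ← h1]
    abel
  σ k hk x := by
    by_cases hk' : k = c
    · subst hk'
      simp only [adj, if_true]
      change ψ 0 + Y.σ k (ψ x.1) = Y.σ k (ψ x.1 + Y.σ k (ψ x.2))
      rw [map_add, Y.σsq k hk, map_zero, zero_add, add_zero]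
    · have h2 := h.σ k (by omega)
      have h3 := Y.σσ k (by omega) c (by omega) (ψ x.2)
      change ∀ x, ψ (V.σ k x) = Y.σ k (ψ x) at h2
      simp only [adj, if_neg hk']
      change ψ (V.σ k x.1) + Y.σ c (ψ (- V.σ k x.2)) = Y.σ k (ψ x.1 + Y.σ c (ψ x.2))
      rw [map_neg, map_neg, h2, h2, map_add, eq_neg_of_add_eq_zero_left h3]
  mem n x hx := by
    obtain ⟨h1, h2⟩ := hx
    have h3 := Y.σ_mem c (by omega) (n-1) _ (h.mem _ _ h2)
    simp only [sub_add_cancel] at h3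
    exact add_mem (h.mem _ _ h1) h3

lemma cover_zero (Y : DGm f 0) : ∃ P : DGm f 0, P.Proj ∧ ∃ φ, IsHom P Y φ ∧ Surj P Y φ := by
  classical
  obtain ⟨B, hB⟩ := Y.bdd
  have hc : ∀ n, ∃ (b : ℕ) (π : (Fin b → Q) →ₗ[Q] Y.X), LinearMap.range π = Y.gr n := by
    intro n
    have : Module.Finite Q (Y.gr n) := Module.Finite.iff_fg.2 (Y.fg n)
    obtain ⟨b, π, h⟩ := Module.Finite.exists_fin' Q (Y.gr n)
    refine ⟨b, (Y.gr n).subtype ∘ₗ π, ?_⟩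
    rw [LinearMap.range_comp, LinearMap.range_eq_top.2 h]; simp
  choose b π hπ using hc
  let W : ℤ → Type := fun n => (Fin (b n) → Q) × (Fin (b (n + 1)) → Q)
  let dV : (∀ n, W n) →ₗ[Q] (∀ n, W n) := LinearMap.pi fun n =>
    if 0 ≤ n then (LinearMap.inr Q _ _) ∘ₗ (LinearMap.fst Q _ _) ∘ₗ (LinearMap.proj (n + 1)) else 0
  have hdV : ∀ g n, dV g n = if 0 ≤ n then (0, (g (n+1)).1) else 0 := by
    intro g n
    simp only [dV, LinearMap.pi_apply]
    split_ifs <;> rfl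
  let gV : ℤ → Submodule Q (∀ n, W n) := fun n => if 0 ≤ n ∧ n ≤ B then
    LinearMap.range (LinearMap.single Q W n) else ⊥
  have hgV : ∀ n g, g ∈ gV n ↔ (∀ m, (m ≠ n ∨ m < 0 ∨ B < m) → g m = 0) := by
    intro n g
    simp only [gV]
    split_ifs with h
    · constructor
      · rintro ⟨w, rfl⟩ m hm
        have : m ≠ n := by omega
        simp [Pi.single_eq_of_ne this]
      · intro H
        refine ⟨g n, ?_⟩
        ext1 m
        by_cases hm : m = n
        · subst hm; simp
        · simp [Pi.single_eq_of_ne hm, H m (Or.inl hm)]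
    · constructor
      · intro h; simp only [Submodule.mem_bot] at h; simp [h]
      · intro H
        simp only [Submodule.mem_bot]
        ext1 m
        exact H m (by omega)
  let V : DGm f 0 :=
    { X := ∀ n, W n
      gr := gV
      d := dV
      σ := fun _ => 0
      d_mem := by
        intro n g hg
        rw [hgV] at hg ⊢
        intro m hm
        rw [hdV]
        split_ifs with h0
        · rw [hg (m+1) (by omega)]; rfl
        · rfl
      σ_mem := by intro k hk; omega
      neg := by intro n hn; simp only [gV]; rw [if_neg (by omega)]
      bdd := ⟨B, by intro n hn; simp only [gV]; rw [if_neg (by omega)]⟩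
      fg := by
        intro n
        simp only [gV]
        split_ifs
        · exact Module.Finite.iff_fg.1 (Module.Finite.range _)
        · exact Submodule.fg_bot
      dd := by
        intro x
        ext1 n
        rw [hdV, hdV]
        split_ifs <;> rfl
      dσ := by intro k hk; omega
      σσ := by intro k hk; omega
      σsq := by intro k hk; omega }
  let φ : (∀ n, W n) →ₗ[Q] Y.X := ∑ n ∈ Finset.Icc 0 B,
    ((π n).coprod (Y.d ∘ₗ π (n+1))) ∘ₗ (LinearMap.proj n)
  have hφ : ∀ g, φ g = ∑ n ∈ Finset.Icc 0 B, (π n (g n).1 + Y.d (π (n+1) (g n).2)) := by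
    intro g; simp [φ]
  have hπm : ∀ n w, π n w ∈ Y.gr n := fun n w => hπ n ▸ ⟨w, rfl⟩
  refine ⟨V, ?_, φ, ⟨?_, by intro k hk; omega, ?_⟩, ?_⟩
  · intro n
    change Module.Projective Q (gV n)
    by_cases hn : 0 ≤ n ∧ n ≤ B
    · have : gV n = LinearMap.range (LinearMap.single Q W n) := if_pos hn
      rw [this]
      exact Module.Projective.of_equiv (LinearEquiv.ofInjective (LinearMap.single Q W n)
        (Pi.single_injective n))
    · have : gV n = ⊥ := if_neg hn
      rw [this]
      infer_instance
  · intro g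
    change φ (dV g) = _
    rw [hφ, hφ, map_sum]
    have e1 : ∀ n ∈ Finset.Icc 0 B, (π n (dV g n).1 + Y.d (π (n+1) (dV g n).2)) =
        Y.d (π (n+1) (g (n+1)).1) := by
      intro n hn
      rw [hdV, if_pos (Finset.mem_Icc.1 hn).1]; simp
    have e2 : ∀ n ∈ Finset.Icc 0 B, Y.d (π n (g n).1 + Y.d (π (n+1) (g n).2)) =
        Y.d (π n (g n).1) := by
      intro n hn
      simp [Y.dd]
    rw [Finset.sum_congr rfl e1, Finset.sum_congr rfl e2]
    rcases lt_or_ge B 0 with hB0 | hB0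
    · rw [Finset.Icc_eq_empty (by omega)]; simp
    let h : ℤ → Y.X := fun n => Y.d (π n (g n).1)
    change ∑ n ∈ Finset.Icc 0 B, h (n+1) = ∑ n ∈ Finset.Icc 0 B, h n
    have h0 : h 0 = 0 := by
      have := Y.d_mem 0 _ (hπm 0 (g 0).1)
      rw [Y.neg _ (by omega)] at this
      simpa using this
    have hB1 : h (B+1) = 0 := by
      have := (hπm (B+1) (g (B+1)).1)
      rw [hB _ (by omega)] at this
      simp only [Submodule.mem_bot] at this
      simp [h, this]
    have e3 : ∑ n ∈ Finset.Icc 0 B, h (n+1) = ∑ n ∈ Finset.Icc 1 (B+1), h n := by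
      refine Finset.sum_bij (fun n _ => n + 1) ?_ ?_ ?_ ?_
      · intro n hn; simp at hn ⊢; omega
      · intro n _ m _ h; simpa using h
      · intro n hn; simp at hn; exact ⟨n-1, by simp; omega, by simp⟩
      · intro n hn; rfl
    rw [e3]
    have e4 : ∑ n ∈ Finset.Icc 1 (B+1), h n = ∑ n ∈ Finset.Icc 0 (B+1), h n := by
      refine Finset.sum_subset (Finset.Icc_subset_Icc (by omega) le_rfl) ?_
      intro n hn hn'
      simp at hn hn'
      rw [show n = 0 by omega, h0]
    have e5 : ∑ n ∈ Finset.Icc 0 B, h n = ∑ n ∈ Finset.Icc 0 (B+1), h n := by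
      refine Finset.sum_subset (Finset.Icc_subset_Icc le_rfl (by omega)) ?_
      intro n hn hn'
      simp at hn hn'
      rw [show n = B + 1 by omega, hB1]
    rw [e4, e5]
  · intro n g hg
    replace hg := (hgV n g).1 hg
    rw [hφ]
    refine Submodule.sum_mem _ fun m hm => ?_
    by_cases h : m = n
    · subst h
      refine add_mem (hπm _ _) ?_
      simpa using Y.d_mem _ _ (hπm (m+1) (g m).2)
    · rw [hg m (Or.inl h)]; simp
  · intro n y hy
    by_cases hn : 0 ≤ n ∧ n ≤ B
    · have := hy
      rw [← hπ n] at this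
      obtain ⟨w, hw⟩ := this
      refine ⟨Pi.single n ((w, 0) : W n), ?_, ?_⟩
      · refine (hgV n _).2 ?_
        intro m hm
        rw [Pi.single_eq_of_ne (by omega)]
      · rw [hφ, Finset.sum_eq_single n]
        · simp [hw]
        · intro m _ hm; rw [Pi.single_eq_of_ne hm]; simp
        · intro h; simp at h; omega
    · refine ⟨0, zero_mem _, ?_⟩
      have : Y.gr n = ⊥ := by
        rcases lt_or_ge n 0 with h | h
        · exact Y.neg n h
        · exact hB n (by omega)
      rw [this] at hy
      simpa using hy.symm

lemma cover : ∀ (c : ℕ) (Y : DGm f c),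
    ∃ P : DGm f c, P.Proj ∧ ∃ φ, IsHom P Y φ ∧ Surj P Y φ
  | 0, Y => cover_zero Y
  | c + 1, Y => by
    obtain ⟨V, hV, ψ, h1, h2⟩ := cover c Y.forget
    refine ⟨V.adj, fun n => proj_prod _ _ (hV n) (hV (n-1)), _, adj_hom V Y ψ h1, ?_⟩
    intro n y hy
    obtain ⟨x, hx, hxy⟩ := h2 n y hy
    refine ⟨(x, 0), ⟨hx, zero_mem _⟩, ?_⟩
    have e : Y.σ c (ψ 0) = 0 := (congrArg (Y.σ c) (map_zero ψ)).trans (map_zero (Y.σ c))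
    have e2 : (ψ x : Y.X) = y := hxy
    exact (congrArg₂ (fun a b : Y.X => a + b) e2 e).trans (add_zero y)

/-- kernel -/
noncomputable def kern [IsNoetherianRing Q] (P Y : DGm f c) (φ : P.X →ₗ[Q] Y.X)
    (h : IsHom P Y φ) : DGm f c where
  X := LinearMap.ker φ
  gr n := (P.gr n).comap (LinearMap.ker φ).subtype
  d := P.d.restrict (p := LinearMap.ker φ) (q := LinearMap.ker φ)
    (fun x hx => by rw [LinearMap.mem_ker] at hx ⊢; rw [h.d, hx, map_zero])
  σ k := if hk : k < c then (P.σ k).restrict (p := LinearMap.ker φ) (q := LinearMap.ker φ)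
    (fun x hx => by rw [LinearMap.mem_ker] at hx ⊢; rw [h.σ k hk, hx, map_zero]) else 0
  d_mem n x hx := P.d_mem n _ hx
  σ_mem k hk n x hx := by rw [dif_pos hk]; exact P.σ_mem k hk n _ hx
  neg n hn := by rw [P.neg n hn]; simp
  bdd := by
    obtain ⟨B, hB⟩ := P.bdd
    refine ⟨B, fun n hn => ?_⟩
    rw [hB n hn]; simp
  fg n := by
    have : IsNoetherian Q (P.gr n) := isNoetherian_of_fg_of_noetherian _ (P.fg n)
    refine Submodule.fg_of_fg_map_injective (LinearMap.ker φ).subtype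
      Subtype.val_injective ?_
    exact (isNoetherian_submodule.1 this) _ (Submodule.map_comap_le _ _)
  dd x := Subtype.ext (P.dd x)
  dσ k hk x := by rw [dif_pos hk]; exact Subtype.ext (P.dσ k hk x)
  σσ k hk l hl x := by rw [dif_pos hk, dif_pos hl]; exact Subtype.ext (P.σσ k hk l hl x)
  σsq k hk x := by rw [dif_pos hk]; exact Subtype.ext (P.σsq k hk x)

/-- mapping cone -/
noncomputable def cone (F P : DGm f c) (φ : F.X →ₗ[Q] P.X) (h : IsHom F P φ) : DGm f c where
  X := P.X × F.X
  gr n := (P.gr n).prod (F.gr (n - 1))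
  d := LinearMap.prod (P.d.coprod φ) ((0 : P.X →ₗ[Q] F.X).coprod (-F.d))
  σ k := LinearMap.prodMap (P.σ k) (- F.σ k)
  d_mem n x hx := by
    obtain ⟨h1, h2⟩ := hx
    refine ⟨?_, ?_⟩
    · simpa using add_mem (P.d_mem n _ h1) (h.mem _ _ h2)
    · simpa using F.d_mem (n-1) _ h2
  σ_mem k hk n x hx := by
    obtain ⟨h1, h2⟩ := hx
    refine ⟨by simpa using P.σ_mem k (by omega) n _ h1, ?_⟩
    have := F.σ_mem k (by omega) (n-1) _ h2
    simp only [LinearMap.prodMap_apply, LinearMap.neg_apply]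
    rw [show n + 1 - 1 = n - 1 + 1 by ring]
    exact neg_mem this
  neg n hn := by
    rw [P.neg n hn, F.neg (n-1) (by omega)]; simp
  bdd := by
    obtain ⟨B, hB⟩ := P.bdd
    obtain ⟨B', hB'⟩ := F.bdd
    refine ⟨max B B' + 1, fun n hn => ?_⟩
    rw [hB n (by omega), hB' (n-1) (by omega)]; simp
  fg n := (P.fg n).prod (F.fg (n-1))
  dd x := by
    ext
    · simp [P.dd, h.d]
    · simp [F.dd]
  dσ k hk x := by
    have h1 := P.dσ k hk x.1
    have h2 := F.dσ k hk x.2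
    ext
    · change P.d (P.σ k x.1) + φ (- F.σ k x.2) + P.σ k (P.d x.1 + φ x.2) = f k • x.1
      rw [← h1, map_add, map_neg, h.σ k hk]
      abel
    · simp [← h2]
  σσ k hk l hl x := by
    have h1 := P.σσ k hk l hl x.1
    have h2 := F.σσ k hk l hl x.2
    ext <;> simp [h1, h2]
  σsq k hk x := by
    ext <;> simp [P.σsq k hk, F.σsq k hk]

theorem resolve [IsNoetherianRing Q] (n : ℕ) : ∀ Y : DGm f c,
    (∀ m, HasProjectiveDimensionLT (ModuleCat.of Q (Y.gr m)) (n + 1)) →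
    ∃ F : DGm f c, F.Proj ∧ ∃ φ, IsHom F Y φ ∧ Surj F Y φ ∧
      ∀ m, ∀ x ∈ F.gr m, φ x = 0 → F.d x = 0 → ∃ w ∈ F.gr (m + 1), φ w = 0 ∧ F.d w = x := by
  induction n with
  | zero =>
    intro Y h
    refine ⟨Y, ?_, LinearMap.id, ⟨fun _ => rfl, fun _ _ _ => rfl, fun _ _ h => h⟩,
      fun n y hy => ⟨y, hy, rfl⟩, ?_⟩
    · intro m
      have := h m
      have := (projective_iff_hasProjectiveDimensionLT_one (X := ModuleCat.of Q (Y.gr m))).2 this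
      exact (IsProjective.iff_projective _).2 this
    · intro m x _ h _
      refine ⟨0, zero_mem _, by simp, ?_⟩
      simp only [LinearMap.id_apply] at h
      simp [h]
  | succ n ih =>
    intro Y h
    obtain ⟨P, hP, φ, hφ, hs⟩ := cover c Y
    obtain ⟨F', hF', φ', hφ', hs', ha'⟩ := ih (kern P Y φ hφ) (by
      intro m
      let i : ((P.gr m).comap (LinearMap.ker φ).subtype) →ₗ[Q] P.gr m :=
        LinearMap.restrict (LinearMap.ker φ).subtype (fun x hx => hx)
      let S : ShortComplex (ModuleCat Q) := ShortComplex.mk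
        (ModuleCat.ofHom i)
        (ModuleCat.ofHom (LinearMap.restrict φ (p := P.gr m) (q := Y.gr m) (hφ.mem m)))
        (ModuleCat.hom_ext (LinearMap.ext fun (x : ((P.gr m).comap (LinearMap.ker φ).subtype)) => Subtype.ext x.1.2))
      have hS : S.ShortExact :=
        { exact := by
            rw [ShortComplex.moduleCat_exact_iff]
            intro x hx
            refine ⟨⟨⟨x.1, ?_⟩, x.2⟩, rfl⟩
            exact congrArg Subtype.val hx
          mono_f := by
            rw [ModuleCat.mono_iff_injective]
            intro x y hxy
            apply Subtype.ext; apply Subtype.ext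
            have h2 : i x = i y := hxy
            have h3 : (i x).1 = (i y).1 := by rw [h2]
            exact h3
          epi_g := by
            rw [ModuleCat.epi_iff_surjective]
            intro y
            obtain ⟨x, hx, hxy⟩ := hs m y.1 y.2
            exact ⟨⟨x, hx⟩, Subtype.ext hxy⟩ }
      have hp : Projective S.X₂ := (IsProjective.iff_projective _).1 (hP m)
      exact (hS.hasProjectiveDimensionLT_X₃_iff n hp).1 (h m))
    have hφ'' : IsHom F' P ((LinearMap.ker φ).subtype ∘ₗ φ') :=
      { d := fun x => congrArg Subtype.val (hφ'.d x)
        σ := fun k hk x => by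
          have := congrArg Subtype.val (hφ'.σ k hk x)
          simp only [kern, dif_pos hk] at this
          exact this
        mem := fun n x hx => hφ'.mem n x hx }
    refine ⟨cone F' P _ hφ'', fun m => proj_prod _ _ (hP m) (hF' (m-1)),
      φ ∘ₗ LinearMap.fst Q _ _, ⟨?_, ?_, ?_⟩, ?_, ?_⟩
    · intro x
      have := (φ' x.2).2
      rw [LinearMap.mem_ker] at this
      change φ (P.d x.1 + (φ' x.2).1) = Y.d (φ x.1)
      rw [map_add, hφ.d, this, add_zero]
    · intro k hk x
      exact hφ.σ k hk _
    · intro n x hx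
      exact hφ.mem n _ hx.1
    · intro n y hy
      obtain ⟨x, hx, hxy⟩ := hs n y hy
      exact ⟨(x, 0), ⟨hx, zero_mem _⟩, hxy⟩
    · rintro m ⟨p, x⟩ ⟨hp, hx⟩ h1 h2
      change φ p = 0 at h1
      change p ∈ P.gr m at hp
      change x ∈ F'.gr (m - 1) at hx
      have h3 : P.d p + (φ' x).1 = 0 := congrArg Prod.fst h2
      have h4 : F'.d x = 0 := by
        have := congrArg Prod.snd h2
        change (0 : P.X →ₗ[Q] F'.X) p + - F'.d x = 0 at this
        simpa using this
      obtain ⟨x1, hx1, hx1'⟩ := hs' m ⟨p, h1⟩ hp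
      have h5 : φ' (x + F'.d x1) = 0 := by
        rw [map_add, hφ'.d, hx1']
        apply Subtype.ext
        change (φ' x).1 + P.d p = 0
        rw [← h3, add_comm]
      obtain ⟨w, hw, hw1, hw2⟩ := ha' (m-1) (x + F'.d x1) (add_mem hx (F'.d_mem _ _ hx1)) h5
        (by rw [map_add, h4, F'.dd, add_zero])
      rw [sub_add_cancel] at hw
      refine ⟨(0, x1 - w), ⟨zero_mem _, ?_⟩, map_zero φ, ?_⟩
      · change x1 - w ∈ F'.gr (m + 1 - 1)
        rw [add_sub_cancel_right]
        exact sub_mem hx1 hw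
      · have : F'.d w = x + F'.d x1 := hw2
        refine Prod.ext ?_ ?_
        · change P.d 0 + (φ' (x1 - w)).1 = p
          rw [map_sub, hx1', hw1, map_zero, zero_add]
          exact sub_zero p
        · change (0 : P.X →ₗ[Q] F'.X) 0 + - F'.d (x1 - w) = x
          rw [map_sub, this, map_zero]
          abel

end DGm

-- Part 2

section reg
variable {Q : Type} [CommRing Q]

lemma smul_functional {X : Type} [AddCommGroup X] [Module Q X] (N : Submodule Q X) (J : Ideal Q)
    (g : N →ₗ[Q] Q) (x : N) (hx : x.1 ∈ J • N) : g x ∈ J := by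
  have key : ∀ y ∈ J • N, ∀ h : y ∈ N, g ⟨y, h⟩ ∈ J := by
    intro y hy
    induction hy using Submodule.smul_induction_on' with
    | smul r hr n hn =>
      intro h
      have : (⟨r • n, h⟩ : N) = r • ⟨n, hn⟩ := rfl
      rw [this, map_smul, smul_eq_mul]
      exact J.mul_mem_right _ hr
    | add x hx y hy h1 h2 =>
      intro h
      have hx' : x ∈ N := Submodule.smul_le_right hx
      have hy' : y ∈ N := Submodule.smul_le_right hy
      have : (⟨x + y, h⟩ : N) = ⟨x, hx'⟩ + ⟨y, hy'⟩ := rfl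
      rw [this, map_add]
      exact J.add_mem (h1 _) (h2 _)
  exact key x.1 hx x.2

lemma proj_reg {X : Type} [AddCommGroup X] [Module Q X] (N : Submodule Q X) (J : Ideal Q)
    (hN : Module.Projective Q N) (r : Q) (h : ∀ y, r * y ∈ J → y ∈ J) (x : X) (hx : x ∈ N)
    (hrx : r • x ∈ J • N) : x ∈ J • N := by
  obtain ⟨s, hs⟩ := hN.out
  have h1 : ∀ n : N, s ⟨x, hx⟩ n ∈ J := by
    intro n
    apply h
    have := smul_functional N J (Finsupp.lapply n ∘ₗ s) (r • ⟨x, hx⟩) hrx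
    rw [map_smul] at this
    exact this
  have h2 := congrArg Subtype.val (hs ⟨x, hx⟩)
  rw [Finsupp.linearCombination_apply, Finsupp.sum] at h2
  change _ = x at h2
  rw [← h2, AddSubmonoidClass.coe_finsetSum]
  exact Submodule.sum_mem _ fun n _ => Submodule.smul_mem_smul (h1 n) n.2

def Jd (f : ℕ → Q) (j : ℕ) : Ideal Q := Ideal.span (f '' {i | i < j})

lemma Jd_succ (f : ℕ → Q) (j : ℕ) : Jd f (j + 1) = Ideal.span {f j} ⊔ Jd f j := by
  unfold Jd
  rw [← Ideal.span_union]
  congr 1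
  ext x
  simp only [Set.mem_image, Set.mem_ofPred_eq, Set.mem_union, Set.mem_singleton_iff]
  constructor
  · rintro ⟨i, hi, rfl⟩
    by_cases h : i = j
    · left; rw [h]
    · right; exact ⟨i, by omega, rfl⟩
  · rintro (rfl | ⟨i, hi, rfl⟩)
    · exact ⟨j, by omega, rfl⟩
    · exact ⟨i, by omega, rfl⟩

lemma Jd_le (f : ℕ → Q) (j : ℕ) : Jd f j ≤ Jd f (j + 1) := by
  rw [Jd_succ]; exact le_sup_right

lemma mem_Jd (f : ℕ → Q) {i j : ℕ} (h : i < j) : f i ∈ Jd f j :=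
  Ideal.subset_span ⟨i, h, rfl⟩

lemma mem_Jd_succ_smul {X : Type} [AddCommGroup X] [Module Q X] (N : Submodule Q X)
    (f : ℕ → Q) (j : ℕ) (x : X) (hx : x ∈ Jd f (j + 1) • N) :
    ∃ w ∈ N, ∃ u ∈ Jd f j • N, x = f j • w + u := by
  rw [Jd_succ, Submodule.sup_smul, Submodule.mem_sup] at hx
  obtain ⟨y, hy, u, hu, rfl⟩ := hx
  rw [Submodule.ideal_span_singleton_smul] at hy
  obtain ⟨w, hw, rfl⟩ := hy
  exact ⟨w, hw, u, hu, rfl⟩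

lemma map_smul_mem {X Y : Type} [AddCommGroup X] [Module Q X] [AddCommGroup Y] [Module Q Y]
    (φ : X →ₗ[Q] Y) (J : Ideal Q) (N : Submodule Q X) (N' : Submodule Q Y)
    (h : ∀ x ∈ N, φ x ∈ N') (x : X) (hx : x ∈ J • N) : φ x ∈ J • N' := by
  have : (J • N).map φ ≤ J • N' := by
    rw [Submodule.map_smul'']
    exact Submodule.smul_mono le_rfl (by rintro _ ⟨y, hy, rfl⟩; exact h y hy)
  exact this ⟨x, hx, rfl⟩

end reg

structure Stage {Q : Type} [CommRing Q] (f : ℕ → Q) (c : ℕ) (M : Type) [AddCommGroup M]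
    [Module Q M] (j : ℕ) where
  X : Type
  [ag : AddCommGroup X]
  [mod : Module Q X]
  gr : ℤ → Submodule Q X
  d : X →ₗ[Q] X
  σ : ℕ → X →ₗ[Q] X
  t : ℕ → X →ₗ[Q] X
  s : ℕ → X →ₗ[Q] X
  ε : X →ₗ[Q] M
  proj : ∀ n, Module.Projective Q (gr n)
  fg : ∀ n, Module.Finite Q (gr n)
  neg : ∀ n < 0, gr n = ⊥
  d_mem : ∀ n x, x ∈ gr n → d x ∈ gr (n - 1)
  σ_mem : ∀ k, j ≤ k → k < c → ∀ n x, x ∈ gr n → σ k x ∈ gr (n + 1)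
  t_mem : ∀ l < j, ∀ n x, x ∈ gr n → t l x ∈ gr (n - 2)
  s_mem : ∀ l < j, ∀ n x, x ∈ gr n → s l x ∈ gr (n + 2)
  dd : ∀ x, d (d x) = ∑ i ∈ Finset.range j, f i • t i x
  dσ : ∀ k, j ≤ k → k < c → ∀ x, d (σ k x) + σ k (d x) = f k • x
  σσ : ∀ k, j ≤ k → k < c → ∀ l, j ≤ l → l < c → ∀ x, σ k (σ l x) + σ l (σ k x) = 0
  σsq : ∀ k, j ≤ k → k < c → ∀ x, σ k (σ k x) = 0
  td : ∀ l < j, ∀ x, t l (d x) = d (t l x)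
  tσ : ∀ l < j, ∀ k, j ≤ k → k < c → ∀ x, t l (σ k x) = σ k (t l x)
  tt : ∀ l < j, ∀ k < j, ∀ x, t l (t k x) = t k (t l x)
  st : ∃ i1 : ℤ, ∀ n ≥ i1, ∀ x ∈ gr (n + 2), ∑ l ∈ Finset.range j, s l (t l x) = x
  ex : ∀ n ≥ 1, ∀ x ∈ gr n, d x ∈ Jd f j • gr (n - 1) → ∃ y ∈ gr (n + 1), x - d y ∈ Jd f j • gr n
  ε_surj : ∀ m, ∃ x ∈ gr 0, ε x = m
  ε_d : ∀ x ∈ gr 1, ε (d x) = 0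
  ε_ex : ∀ x ∈ gr 0, ε x = 0 → ∃ y ∈ gr 1, x - d y ∈ Jd f j • gr 0

attribute [instance] Stage.ag Stage.mod

namespace Stage
variable {Q : Type} [CommRing Q] {f : ℕ → Q} {c : ℕ} {M : Type} [AddCommGroup M]
    [Module Q M] {j : ℕ}

def gr' (S : Stage f c M j) (n : ℤ) : Submodule Q (ℕ → S.X) where
  carrier := {x | ∀ k : ℕ, x k ∈ S.gr (n - 2 * k)}
  add_mem' h1 h2 k := add_mem (h1 k) (h2 k)
  zero_mem' _ := zero_mem _
  smul_mem' r _ h k := Submodule.smul_mem _ r (h k)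

def d' (S : Stage f c M j) : (ℕ → S.X) →ₗ[Q] (ℕ → S.X) :=
  LinearMap.pi fun k => S.d ∘ₗ LinearMap.proj k + S.σ j ∘ₗ LinearMap.proj (k + 1)

lemma d'_apply (S : Stage f c M j) (x : ℕ → S.X) (k : ℕ) :
    S.d' x k = S.d (x k) + S.σ j (x (k + 1)) := rfl

lemma zero_of_neg (S : Stage f c M j) {n : ℤ} (hn : n < 0) {x : S.X} (hx : x ∈ S.gr n) :
    x = 0 := by
  rw [S.neg n hn] at hx
  simpa using hx

lemma single_mem (S : Stage f c M j) (n m : ℤ) (k : ℕ) (hm : m = n - 2 * k) (x : S.X)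
    (hx : x ∈ S.gr m) : (Pi.single k x : ℕ → S.X) ∈ S.gr' n := by
  subst hm
  intro i
  by_cases h : i = k
  · subst h; simpa using hx
  · simp [h]

lemma smul_gr' (S : Stage f c M j) (J : Ideal Q) (n : ℤ) (x : ℕ → S.X) :
    x ∈ J • S.gr' n ↔ ∀ k : ℕ, x k ∈ J • S.gr (n - 2 * k) := by
  constructor
  · intro h k
    exact map_smul_mem (LinearMap.proj k : (ℕ → S.X) →ₗ[Q] S.X) J (S.gr' n) _ (fun x hx => hx k) x h
  · intro h
    have h0 : ∀ k : ℕ, n.toNat + 1 ≤ k → x k = 0 := by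
      intro k hk
      exact S.zero_of_neg (n := n - 2 * k) (by omega) (Submodule.smul_le_right (h k))
    have h1 : x = ∑ k ∈ Finset.range (n.toNat + 1), Pi.single k (x k) := by
      funext i
      rw [Finset.sum_apply]
      by_cases hi : i < n.toNat + 1
      · rw [Finset.sum_eq_single i]
        · simp
        · intro b _ hb
          simp [Ne.symm hb]
        · intro h'; simp at h'; omega
      · rw [h0 i (by omega), Finset.sum_eq_zero]
        intro b hb
        rw [Finset.mem_range] at hb
        have : i ≠ b := by omega
        simp [this]
    rw [h1]
    apply Submodule.sum_mem
    intro k _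
    exact map_smul_mem (LinearMap.single Q (fun _ : ℕ => S.X) k) J (S.gr (n - 2 * k)) _
      (fun y hy => S.single_mem n _ k rfl y hy) _ (h k)

def grEquiv (S : Stage f c M j) (n : ℤ) :
    S.gr' n ≃ₗ[Q] ((k : Fin (n.toNat + 1)) → S.gr (n - 2 * (k : ℕ))) where
  toFun x k := ⟨x.1 k, x.2 k⟩
  invFun y := ⟨fun k => if h : k < n.toNat + 1 then (y ⟨k, h⟩).1 else 0, by
    intro k
    dsimp only
    split_ifs with h
    · exact (y ⟨k, h⟩).2
    · exact zero_mem _⟩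
  map_add' _ _ := rfl
  map_smul' _ _ := rfl
  left_inv x := by
    apply Subtype.ext
    funext k
    dsimp only
    split_ifs with h
    · rfl
    · exact (S.zero_of_neg (by omega) (x.2 k)).symm
  right_inv y := by
    funext k
    apply Subtype.ext
    dsimp only
    rw [dif_pos k.2]

lemma dd_mem (S : Stage f c M j) (n : ℤ) (x : S.X) (hx : x ∈ S.gr n) :
    S.d (S.d x) ∈ Jd f j • S.gr (n - 2) := by
  rw [S.dd]
  apply Submodule.sum_mem
  intro i hi
  rw [Finset.mem_range] at hi
  exact Submodule.smul_mem_smul (mem_Jd f hi) (S.t_mem i hi _ _ hx)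

lemma d'_mem (S : Stage f c M j) (hj : j < c) (n : ℤ) (x) (hx : x ∈ S.gr' n) :
    S.d' x ∈ S.gr' (n - 1) := by
  intro k
  rw [d'_apply]
  apply add_mem
  · have := S.d_mem _ _ (hx k)
    rwa [show n - 1 - 2 * (k : ℤ) = n - 2 * k - 1 by ring]
  · have := S.σ_mem j le_rfl hj _ _ (hx (k + 1))
    rwa [show n - 1 - 2 * (k : ℤ) = n - 2 * ((k + 1 : ℕ) : ℤ) + 1 by push_cast; ring]

lemma dd' (S : Stage f c M j) (hj : j < c) (x : ℕ → S.X) (k : ℕ) :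
    S.d' (S.d' x) k = S.d (S.d (x k)) + f j • x (k + 1) := by
  simp only [d'_apply, map_add]
  rw [S.σsq j le_rfl hj, add_zero, add_assoc, S.dσ j le_rfl hj]

lemma dd'_mem (S : Stage f c M j) (hj : j < c) (n : ℤ) (x) (hx : x ∈ S.gr' n) (k : ℕ) :
    S.d' (S.d' x) k ∈ Jd f (j + 1) • S.gr (n - 2 * k - 2) := by
  rw [S.dd' hj]
  apply add_mem
  · exact Submodule.smul_mono_left (Jd_le f j) (S.dd_mem _ _ (hx k))
  · apply Submodule.smul_mem_smul (mem_Jd f (by omega))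
    have := hx (k + 1)
    rwa [show n - 2 * (k : ℤ) - 2 = n - 2 * ((k + 1 : ℕ) : ℤ) by push_cast; ring]

lemma d_smul (S : Stage f c M j) (J : Ideal Q) (n : ℤ) (x) (hx : x ∈ J • S.gr n) :
    S.d x ∈ J • S.gr (n - 1) :=
  map_smul_mem S.d J _ _ (S.d_mem n) x hx

lemma σ_smul (S : Stage f c M j) (hj : j < c) (J : Ideal Q) (n : ℤ) (x) (hx : x ∈ J • S.gr n) :
    S.σ j x ∈ J • S.gr (n + 1) :=
  map_smul_mem (S.σ j) J _ _ (S.σ_mem j le_rfl hj n) x hx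

lemma step1 (S : Stage f c M j) (hj : j < c) (hf : ∀ y, f j * y ∈ Jd f j → y ∈ Jd f j)
    (m : ℤ) (hm : 1 ≤ m) (z : S.X) (hz : z ∈ S.gr m)
    (h : S.d z ∈ Jd f (j + 1) • S.gr (m - 1)) :
    ∃ y ∈ S.gr (m + 1), ∃ w ∈ S.gr (m - 1), z - S.d y - S.σ j w ∈ Jd f j • S.gr m ∧
      S.d w ∈ Jd f j • S.gr (m - 2) := by
  obtain ⟨w, hw, u, hu, h1⟩ := mem_Jd_succ_smul _ f j _ h
  have e : m - 1 - 1 = m - 2 := by ring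
  have e' : m - 2 + 1 = m - 1 := by ring
  have e'' : m - 1 + 1 = m := by ring
  have hdw : S.d w ∈ Jd f j • S.gr (m - 2) := by
    apply proj_reg _ _ (S.proj _) _ hf
    · have := S.d_mem _ _ hw
      rwa [e] at this
    · have h2 := S.dd_mem _ _ hz
      have h3 := S.d_smul _ _ _ hu
      rw [e] at h3
      have h4 : f j • S.d w = S.d (S.d z) - S.d u := by rw [h1]; simp
      rw [h4]
      exact sub_mem h2 h3
  have hσw := S.σ_mem j le_rfl hj _ _ hw
  rw [e''] at hσw
  obtain ⟨y, hy, h5⟩ := S.ex m hm (z - S.σ j w) (sub_mem hz hσw) (by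
    have h6 : S.d (z - S.σ j w) = u + S.σ j (S.d w) := by
      rw [map_sub, h1, ← S.dσ j le_rfl hj w]; abel
    rw [h6]
    apply add_mem hu
    have := S.σ_smul hj _ _ _ hdw
    rwa [e'] at this)
  refine ⟨y, hy, w, hw, ?_, hdw⟩
  rwa [sub_right_comm]

lemma step2 (S : Stage f c M j) (hj : j < c) (hf : ∀ y, f j * y ∈ Jd f j → y ∈ Jd f j)
    (z z' : S.X) (hz : z ∈ S.gr 0) (hz' : z' ∈ S.gr 2)
    (h : S.d z' + S.σ j z ∈ Jd f (j + 1) • S.gr 1) :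
    ∃ w ∈ S.gr 1, z - S.d w ∈ Jd f j • S.gr 0 := by
  obtain ⟨w, hw, u, hu, h1⟩ := mem_Jd_succ_smul _ f j _ h
  refine ⟨w, hw, ?_⟩
  apply proj_reg _ _ (S.proj _) _ hf
  · have h5 := S.d_mem _ _ hw
    rw [show (1 : ℤ) - 1 = 0 by ring] at h5
    exact sub_mem hz h5
  · have h0 : S.d z = 0 := S.zero_of_neg (n := 0 - 1) (by omega) (S.d_mem _ _ hz)
    have h2 := S.dσ j le_rfl hj z
    rw [h0, map_zero, add_zero] at h2
    have h3 := congrArg S.d h1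
    simp only [map_add, map_smul] at h3
    rw [h2] at h3
    have h4 : f j • (z - S.d w) = S.d u - S.d (S.d z') := by
      rw [smul_sub, sub_eq_sub_iff_add_eq_add, add_comm _ (S.d (S.d z')), h3, add_comm]
    rw [h4]
    have h5 := S.d_smul _ _ _ hu
    have h6 := S.dd_mem _ _ hz'
    rw [show (1 : ℤ) - 1 = 0 by ring] at h5
    rw [show (2 : ℤ) - 2 = 0 by ring] at h6
    exact sub_mem h5 h6

lemma ex' (S : Stage f c M j) (hj : j < c) (hf : ∀ y, f j * y ∈ Jd f j → y ∈ Jd f j)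
    (n : ℤ) (hn : 1 ≤ n) (K : ℕ) : ∀ z ∈ S.gr' n,
    (∀ k : ℕ, S.d' z k ∈ Jd f (j + 1) • S.gr (n - 2 * k - 1)) →
    (∀ k ≥ K, z k ∈ Jd f (j + 1) • S.gr (n - 2 * k)) →
    ∃ y ∈ S.gr' (n + 1), ∀ k : ℕ, (z - S.d' y) k ∈ Jd f (j + 1) • S.gr (n - 2 * k) := by
  induction K with
  | zero =>
    intro z _ _ h
    exact ⟨0, zero_mem _, fun k => by simpa using h k (by omega)⟩
  | succ K ih =>
    intro z hz h1 h2
    -- it suffices to find a correction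
    suffices H : ∃ y ∈ S.gr' (n + 1), ∀ k ≥ K, (z - S.d' y) k ∈ Jd f (j + 1) • S.gr (n - 2 * k) by
      obtain ⟨y, hy, hy2⟩ := H
      obtain ⟨y', hy', hy2'⟩ := ih (z - S.d' y)
        (sub_mem hz (by
          have := S.d'_mem hj _ _ hy
          rwa [add_sub_cancel_right] at this))
        (by
          intro k
          rw [map_sub]
          refine sub_mem (h1 k) ?_
          have := S.dd'_mem hj _ _ hy k
          rwa [show n + 1 - 2 * (k : ℤ) - 2 = n - 2 * k - 1 by ring] at this) hy2
      refine ⟨y + y', add_mem hy hy', fun k => ?_⟩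
      have := hy2' k
      rwa [sub_sub, ← map_add] at this
    rcases lt_trichotomy (n - 2 * (K : ℤ)) 0 with hm | hm | hm
    · refine ⟨0, zero_mem _, fun k hk => ?_⟩
      have : z k = 0 := S.zero_of_neg (n := n - 2 * k) (by omega) (hz k)
      simp [this]
    · obtain ⟨L, rfl⟩ : ∃ L, K = L + 1 := ⟨K - 1, by omega⟩
      have e2 : n - 2 * (L : ℤ) = 2 := by push_cast at hm; omega
      obtain ⟨w, hw, hw2⟩ := S.step2 hj hf (z (L + 1)) (z L)
        (by have := hz (L + 1); rwa [hm] at this)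
        (by have := hz L; rwa [e2] at this)
        (by
          have := h1 L
          rw [e2] at this
          exact this)
      refine ⟨Pi.single (L + 1) w, S.single_mem _ 1 _ (by omega) _ hw, fun k hk => ?_⟩
      by_cases hk2 : k = L + 1
      · subst hk2
        rw [hm]
        have : (z - S.d' (Pi.single (L + 1) w)) (L + 1) = z (L + 1) - S.d w := by
          rw [Pi.sub_apply, d'_apply]; simp
        rw [this]
        exact Submodule.smul_mono_left (Jd_le f j) hw2
      · have h3 : k ≠ L + 1 := hk2
        have h4 : k + 1 ≠ L + 1 := by omega
        have : (z - S.d' (Pi.single (L + 1) w)) k = z k := by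
          rw [Pi.sub_apply, d'_apply, Pi.single_eq_of_ne h3, Pi.single_eq_of_ne h4]; simp
        rw [this]
        exact h2 k (by omega)
    · obtain ⟨y, hy, w, hw, hyw, hdw⟩ := S.step1 hj hf (n - 2 * K) (by omega) (z K) (hz K) (by
        have h3 := h1 K
        rw [d'_apply] at h3
        have h4 := S.σ_smul hj _ _ _ (h2 (K + 1) (by omega))
        rw [show n - 2 * ((K + 1 : ℕ) : ℤ) + 1 = n - 2 * K - 1 by push_cast; ring] at h4
        have := sub_mem h3 h4
        rwa [add_sub_cancel_right] at this)
      refine ⟨Pi.single K y + Pi.single (K + 1) w,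
        add_mem (S.single_mem _ _ _ (by ring) _ hy) (S.single_mem _ _ _ (by push_cast; ring) _ hw),
        fun k hk => ?_⟩
      by_cases hk2 : k = K
      · subst hk2
        have : (z - S.d' (Pi.single k y + Pi.single (k + 1) w)) k = z k - S.d y - S.σ j w := by
          rw [Pi.sub_apply, d'_apply]; simp [sub_sub]
        rw [this]
        exact Submodule.smul_mono_left (Jd_le f j) hyw
      · have h3 : k ≠ K := hk2
        have h4 : k + 1 ≠ K := by omega
        have h6 : k + 1 ≠ K + 1 := by omega
        by_cases hk3 : k = K + 1
        · subst hk3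
          have : (z - S.d' (Pi.single K y + Pi.single (K + 1) w)) (K + 1) = z (K + 1) - S.d w := by
            rw [Pi.sub_apply, d'_apply, Pi.add_apply, Pi.add_apply, Pi.single_eq_of_ne h3,
              Pi.single_eq_of_ne h4, Pi.single_eq_same, Pi.single_eq_of_ne h6]; simp
          rw [this]
          apply sub_mem (h2 _ (by omega))
          rw [show n - 2 * ((K + 1 : ℕ) : ℤ) = n - 2 * K - 2 by push_cast; ring]
          exact Submodule.smul_mono_left (Jd_le f j) hdw
        · have h5 : k ≠ K + 1 := hk3
          have : (z - S.d' (Pi.single K y + Pi.single (K + 1) w)) k = z k := by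
            rw [Pi.sub_apply, d'_apply, Pi.add_apply, Pi.add_apply, Pi.single_eq_of_ne h3,
              Pi.single_eq_of_ne h4, Pi.single_eq_of_ne h5, Pi.single_eq_of_ne h6]; simp
          rw [this]
          exact h2 k (by omega)
end Stage

-- Part 3
namespace Stage
variable {Q : Type} [CommRing Q] {f : ℕ → Q} {c : ℕ} {M : Type} [AddCommGroup M]
    [Module Q M] {j : ℕ}

def compw (S : Stage f c M j) (g : S.X →ₗ[Q] S.X) : (ℕ → S.X) →ₗ[Q] (ℕ → S.X) :=
  LinearMap.pi fun k => g ∘ₗ LinearMap.proj k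

lemma compw_apply (S : Stage f c M j) (g : S.X →ₗ[Q] S.X) (x : ℕ → S.X) (k : ℕ) :
    S.compw g x k = g (x k) := rfl

def t' (S : Stage f c M j) (l : ℕ) : (ℕ → S.X) →ₗ[Q] (ℕ → S.X) :=
  if l = j then LinearMap.pi fun k => LinearMap.proj (k + 1) else S.compw (S.t l)

lemma t'_j (S : Stage f c M j) (x : ℕ → S.X) (k : ℕ) : S.t' j x k = x (k + 1) := by
  simp [t']

lemma t'_l (S : Stage f c M j) (l : ℕ) (h : l < j) (x : ℕ → S.X) (k : ℕ) :
    S.t' l x k = S.t l (x k) := by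
  have : l ≠ j := by omega
  simp [t', this, compw]

def shiftR (S : Stage f c M j) : (ℕ → S.X) →ₗ[Q] (ℕ → S.X) :=
  LinearMap.pi fun k => match k with
    | 0 => 0
    | k + 1 => LinearMap.proj k

def s' (S : Stage f c M j) (l : ℕ) : (ℕ → S.X) →ₗ[Q] (ℕ → S.X) :=
  if l = j then S.shiftR else LinearMap.pi fun k => match k with
    | 0 => S.s l ∘ₗ LinearMap.proj 0
    | _ + 1 => 0

lemma s'_j0 (S : Stage f c M j) (x : ℕ → S.X) : S.s' j x 0 = 0 := by
  simp [s', shiftR]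
lemma s'_js (S : Stage f c M j) (x : ℕ → S.X) (k : ℕ) : S.s' j x (k + 1) = x k := by
  simp [s', shiftR]
lemma s'_l0 (S : Stage f c M j) (l : ℕ) (h : l < j) (x : ℕ → S.X) :
    S.s' l x 0 = S.s l (x 0) := by
  have : l ≠ j := by omega
  simp [s', this]
lemma s'_ls (S : Stage f c M j) (l : ℕ) (h : l < j) (x : ℕ → S.X) (k : ℕ) :
    S.s' l x (k + 1) = 0 := by
  have : l ≠ j := by omega
  simp [s', this]

lemma lt_or (l : ℕ) (h : l < j + 1) : l < j ∨ l = j := by omega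

noncomputable def next (S : Stage f c M j) (hj : j < c)
    (hf : ∀ y, f j * y ∈ Jd f j → y ∈ Jd f j) : Stage f c M (j + 1) where
  X := ℕ → S.X
  gr := S.gr'
  d := S.d'
  σ k := S.compw (S.σ k)
  t := S.t'
  s := S.s'
  ε := S.ε ∘ₗ LinearMap.proj 0
  proj n := by
    have := fun m => S.proj m
    have : Module.Projective Q ((k : Fin (n.toNat + 1)) → S.gr (n - 2 * (k : ℕ))) := 
      Module.Projective.of_equiv (DFinsupp.linearEquivFunOnFintype (R := Q))
    exact Module.Projective.of_equiv (S.grEquiv n).symm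
  fg n := by
    have := fun m => S.fg m
    exact Module.Finite.equiv (S.grEquiv n).symm
  neg n hn := by
    rw [eq_bot_iff]
    intro x hx
    rw [Submodule.mem_bot]
    funext k
    exact S.zero_of_neg (by omega) (hx k)
  d_mem := S.d'_mem hj
  σ_mem k h1 h2 n x hx i := by
    have := S.σ_mem k (by omega) h2 _ _ (hx i)
    rwa [show n - 2 * (i : ℤ) + 1 = n + 1 - 2 * i by ring] at this
  t_mem l hl n x hx k := by
    rcases lt_or l hl with h | rfl
    · rw [S.t'_l l h]
      have := S.t_mem l h _ _ (hx k)
      rwa [show n - 2 * (k : ℤ) - 2 = n - 2 - 2 * k by ring] at this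
    · rw [S.t'_j]
      have := (hx (k + 1))
      rwa [show n - 2 * ((k + 1 : ℕ) : ℤ) = n - 2 - 2 * k by push_cast; ring] at this
  s_mem l hl n x hx k := by
    rcases lt_or l hl with h | rfl
    · rcases k with _ | k
      · rw [S.s'_l0 l h]
        have := S.s_mem l h _ _ (hx 0)
        rwa [show n - 2 * ((0 : ℕ) : ℤ) + 2 = n + 2 - 2 * ((0 : ℕ) : ℤ) by push_cast; ring] at this
      · rw [S.s'_ls l h]; exact zero_mem _
    · rcases k with _ | k
      · rw [S.s'_j0]; exact zero_mem _
      · rw [S.s'_js]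
        have := hx k
        rwa [show n - 2 * (k : ℤ) = n + 2 - 2 * ((k + 1 : ℕ) : ℤ) by push_cast; ring] at this
  dd x := by
    funext k
    rw [S.dd' hj, S.dd, Finset.sum_range_succ, Pi.add_apply, Finset.sum_apply]
    congr 1
    · apply Finset.sum_congr rfl
      intro i hi
      rw [Finset.mem_range] at hi
      rw [Pi.smul_apply, S.t'_l i hi]
    · rw [Pi.smul_apply, S.t'_j]
  dσ k h1 h2 x := by
    funext i
    have h3 := S.dσ k (by omega) h2 (x i)
    have h4 := S.σσ k (by omega) h2 j le_rfl hj (x (i + 1))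
    simp only [Pi.add_apply, S.compw_apply, S.d'_apply, map_add, Pi.smul_apply]
    rw [← h3, eq_comm, ← sub_eq_zero, ← neg_eq_zero, ← h4]
    abel
  σσ k h1 h2 l h3 h4 x := by
    funext i
    exact S.σσ k (by omega) h2 l (by omega) h4 (x i)
  σsq k h1 h2 x := by
    funext i
    exact S.σsq k (by omega) h2 (x i)
  td l hl x := by
    funext k
    rcases lt_or l hl with h | rfl
    · rw [S.t'_l l h, S.d'_apply, S.d'_apply, S.t'_l l h, S.t'_l l h, map_add, S.td l h,
        S.tσ l h j le_rfl hj]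
    · rw [S.t'_j, S.d'_apply, S.d'_apply, S.t'_j, S.t'_j]
  tσ l hl k h1 h2 x := by
    funext i
    rcases lt_or l hl with h | rfl
    · rw [S.t'_l l h, S.compw_apply, S.compw_apply, S.t'_l l h, S.tσ l h k (by omega) h2]
    · rw [S.t'_j, S.compw_apply, S.compw_apply, S.t'_j]
  tt l hl k hk x := by
    funext i
    rcases lt_or l hl with h | rfl <;> rcases lt_or k hk with h' | rfl
    · rw [S.t'_l l h, S.t'_l k h', S.t'_l k h', S.t'_l l h, S.tt l h k h']
    · rw [S.t'_l l h, S.t'_j, S.t'_j, S.t'_l l h]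
    · rw [S.t'_l k h', S.t'_j, S.t'_j, S.t'_l k h']
    · rfl
  st := by
    obtain ⟨i1, h⟩ := S.st
    refine ⟨i1, fun n hn x hx => ?_⟩
    rw [Finset.sum_range_succ]
    funext k
    rw [Pi.add_apply, Finset.sum_apply]
    rcases k with _ | k
    · rw [S.s'_j0, add_zero]
      have h1 := hx 0
      rw [show n + 2 - 2 * ((0 : ℕ) : ℤ) = n + 2 by push_cast; ring] at h1
      conv_rhs => rw [← h n hn _ h1]
      apply Finset.sum_congr rfl
      intro l hl
      rw [Finset.mem_range] at hl
      rw [S.s'_l0 l hl, S.t'_l l hl]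
    · rw [S.s'_js, S.t'_j, Finset.sum_eq_zero, zero_add]
      intro l hl
      rw [Finset.mem_range] at hl
      rw [S.s'_ls l hl]
  ex n hn x hx hdx := by
    obtain ⟨y, hy, h⟩ := S.ex' hj hf n hn (n.toNat + 1) x hx (by
      rw [S.smul_gr'] at hdx
      intro k
      have := hdx k
      rwa [show n - 1 - 2 * (k : ℤ) = n - 2 * k - 1 by ring] at this) (by
      intro k hk
      rw [S.zero_of_neg (by omega) (hx k)]
      exact zero_mem _)
    exact ⟨y, hy, (S.smul_gr' _ _ _).2 h⟩
  ε_surj m := by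
    obtain ⟨x, hx, h⟩ := S.ε_surj m
    exact ⟨Pi.single 0 x, S.single_mem _ _ _ (by simp) _ hx, by simpa using h⟩
  ε_d x hx := by
    change S.ε (S.d' x 0) = 0
    rw [S.d'_apply, S.zero_of_neg (by simp) (hx (0 + 1)), map_zero, add_zero]
    apply S.ε_d
    have := hx 0
    simpa using this
  ε_ex x hx h := by
    have h1 := hx 0
    rw [show 0 - 2 * ((0 : ℕ) : ℤ) = 0 by simp] at h1
    obtain ⟨y, hy, hxy⟩ := S.ε_ex (x 0) h1 h
    refine ⟨Pi.single 0 y, S.single_mem _ _ _ (by simp) _ hy, ?_⟩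
    rw [S.smul_gr']
    intro k
    rw [Pi.sub_apply, S.d'_apply]
    rcases k with _ | k
    · simpa using Submodule.smul_mono_left (Jd_le f j) hxy
    · rw [S.zero_of_neg (by omega) (hx (k + 1))]
      simp

/-- the base stage -/
noncomputable def base (F : DGm f c) (hF : F.Proj) (ε : F.X →ₗ[Q] M)
    (h0 : ∀ m, ∃ x ∈ F.gr 0, ε x = m) (h1 : ∀ x ∈ F.gr 1, ε (F.d x) = 0)
    (h2 : ∀ x ∈ F.gr 0, ε x = 0 → ∃ y ∈ F.gr 1, F.d y = x)
    (h3 : ∀ n ≥ 1, ∀ x ∈ F.gr n, F.d x = 0 → ∃ y ∈ F.gr (n + 1), F.d y = x) :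
    Stage f c M 0 where
  X := F.X
  gr := F.gr
  d := F.d
  σ := F.σ
  t _ := 0
  s _ := 0
  ε := ε
  proj := hF
  fg n := Module.Finite.iff_fg.2 (F.fg n)
  neg := F.neg
  d_mem := F.d_mem
  σ_mem k _ := F.σ_mem k
  t_mem l hl := absurd hl (by omega)
  s_mem l hl := absurd hl (by omega)
  dd x := by simp [F.dd]
  dσ k _ := F.dσ k
  σσ k _ hk l _ hl := F.σσ k hk l hl
  σsq k _ := F.σsq k
  td l hl := absurd hl (by omega)
  tσ l hl := absurd hl (by omega)
  tt l hl := absurd hl (by omega)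
  st := by
    obtain ⟨B, hB⟩ := F.bdd
    refine ⟨B, fun n hn x hx => ?_⟩
    rw [hB _ (by omega)] at hx
    rw [Submodule.mem_bot] at hx
    simp [hx]
  ex n hn x hx h := by
    have : Jd f 0 = ⊥ := by simp [Jd]
    rw [this, Submodule.bot_smul, Submodule.mem_bot] at h
    obtain ⟨y, hy, rfl⟩ := h3 n hn x hx h
    exact ⟨y, hy, by simp⟩
  ε_surj := h0
  ε_d := h1
  ε_ex x hx h := by
    obtain ⟨y, hy, rfl⟩ := h2 x hx h
    exact ⟨y, hy, by simp⟩

lemma exists_stage (S : Stage f c M 0)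
    (hf : ∀ j < c, ∀ y, f j * y ∈ Jd f j → y ∈ Jd f j) : ∀ j ≤ c, Nonempty (Stage f c M j) := by
  intro j
  induction j with
  | zero => exact fun _ => ⟨S⟩
  | succ j ih =>
    intro h
    obtain ⟨T⟩ := ih (by omega)
    exact ⟨T.next (by omega) (hf j (by omega))⟩

/-- `M` placed in degree zero -/
noncomputable def conc (f : ℕ → Q) (c : ℕ) (M : Type) [AddCommGroup M] [Module Q M] [Module.Finite Q M]
    (hM : ∀ k < c, ∀ m : M, f k • m = 0) : DGm f c where
  X := M
  gr n := if n = 0 then ⊤ else ⊥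
  d := 0
  σ _ := 0
  d_mem n x hx := by simp
  σ_mem k _ n x hx := by simp
  neg n hn := by rw [if_neg (by omega)]
  bdd := ⟨0, fun n hn => by rw [if_neg (by omega)]⟩
  fg n := by
    split_ifs
    · exact Module.Finite.fg_top
    · exact Submodule.fg_bot
  dd x := rfl
  dσ k hk x := by simp [hM k hk]
  σσ k _ l _ x := by simp
  σsq k _ x := by simp

theorem exists_final [IsNoetherianRing Q] [Module.Finite Q M] (n : ℕ)
    (hpd : HasProjectiveDimensionLT (ModuleCat.of Q M) (n + 1))
    (hM : ∀ k < c, ∀ m : M, f k • m = 0)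
    (hf : ∀ j < c, ∀ y, f j * y ∈ Jd f j → y ∈ Jd f j) : Nonempty (Stage f c M c) := by
  have key : ∀ N : Submodule Q M, (N = ⊤ ∨ N = ⊥) →
      HasProjectiveDimensionLT (ModuleCat.of Q N) (n + 1) := by
    rintro N (rfl | rfl)
    · have e : ModuleCat.of Q M ≅ ModuleCat.of Q (⊤ : Submodule Q M) :=
        (Submodule.topEquiv (R := Q) (M := M)).symm.toModuleIso
      exact hasProjectiveDimensionLT_of_iso e (n + 1)
    · have : Projective (ModuleCat.of Q (⊥ : Submodule Q M)) :=
        (IsProjective.iff_projective _).1 (inferInstance)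
      have h1 := (projective_iff_hasProjectiveDimensionLT_one
        (X := ModuleCat.of Q (⊥ : Submodule Q M))).1 this
      exact hasProjectiveDimensionLT_of_ge (ModuleCat.of Q (⊥ : Submodule Q M)) 1 (n + 1) (by omega)
  obtain ⟨F, hF, φ, hφ, hs, ha⟩ := DGm.resolve n (conc f c M hM) (by
    intro m
    exact key (if m = 0 then ⊤ else ⊥) (by split_ifs <;> simp))
  have htop : ∀ m : M, m ∈ (if (0 : ℤ) = 0 then ⊤ else ⊥ : Submodule Q M) := by
    intro m
    rw [if_pos rfl]
    exact Submodule.mem_top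
  have hneg : ∀ n ≠ 0, ∀ x ∈ F.gr n, φ x = 0 := by
    intro n hn x hx
    have := hφ.mem n x hx
    change φ x ∈ (if n = 0 then ⊤ else ⊥ : Submodule Q M) at this
    rw [if_neg hn] at this
    exact this
  refine exists_stage (base F hF φ ?_ ?_ ?_ ?_) hf c le_rfl
  · intro m
    exact hs 0 m (htop m)
  · intro x hx
    exact hφ.d x
  · intro x hx h
    have hd : F.d x = 0 := by
      have := F.d_mem _ _ hx
      rw [F.neg _ (by omega)] at this
      exact this
    obtain ⟨w, hw, _, h2⟩ := ha 0 x hx h hd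
    exact ⟨w, hw, h2⟩
  · intro n hn x hx h
    obtain ⟨w, hw, _, h2⟩ := ha n x hx (hneg n (by omega) x hx) h
    exact ⟨w, hw, h2⟩

end Stage

-- Part 4

section extcomp
variable {R : Type} [CommRing R]

noncomputable def homologyEquivAux (S : ShortComplex (ModuleCat.{0} R)) {Y₁ Y₂ Y₃ : Type}
    [AddCommGroup Y₁] [Module R Y₁] [AddCommGroup Y₂] [Module R Y₂] [AddCommGroup Y₃] [Module R Y₃]
    (a : Y₁ →ₗ[R] Y₂) (b : Y₂ →ₗ[R] Y₃) (e₁ : S.X₁ ≃ₗ[R] Y₁) (e₂ : S.X₂ ≃ₗ[R] Y₂)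
    (e₃ : S.X₃ ≃ₗ[R] Y₃) (h₁ : ∀ x, e₂ (S.f.hom x) = a (e₁ x))
    (h₂ : ∀ x, e₃ (S.g.hom x) = b (e₂ x)) :
    S.homology ≃ₗ[R] (LinearMap.ker b ⧸ (LinearMap.range a).comap (LinearMap.ker b).subtype) :=
  (S.moduleCatHomologyIso).toLinearEquiv ≪≫ₗ
    Submodule.Quotient.equiv (LinearMap.range S.moduleCatToCycles)
      ((LinearMap.range a).comap (LinearMap.ker b).subtype)
      (LinearEquiv.ofSubmodules e₂ (LinearMap.ker S.g.hom) (LinearMap.ker b) (by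
        ext y
        rw [Submodule.mem_map, LinearMap.mem_ker]
        constructor
        · rintro ⟨x, hx, rfl⟩
          rw [LinearMap.mem_ker] at hx
          have := h₂ x
          rw [hx, map_zero] at this
          exact this.symm
        · intro hy
          refine ⟨e₂.symm y, ?_, by simp⟩
          rw [LinearMap.mem_ker]
          apply e₃.injective
          rw [h₂, map_zero, LinearEquiv.apply_symm_apply, hy]))
      (by
        ext y
        rw [Submodule.mem_map]
        constructor
        · rintro ⟨x, ⟨z, rfl⟩, rfl⟩
          exact ⟨e₁ z, (h₁ z).symm⟩
        · rintro ⟨z, hz⟩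
          refine ⟨S.moduleCatToCycles (e₁.symm z), ⟨_, rfl⟩, ?_⟩
          apply Subtype.ext
          have := h₁ (e₁.symm z)
          rw [LinearEquiv.apply_symm_apply, hz] at this
          exact this)

variable {M N : Type} [AddCommGroup M] [Module R M] [AddCommGroup N] [Module R N]

noncomputable def extEquiv (P : ProjectiveResolution (ModuleCat.of R M)) (n : ℕ) :
    extAP R M N (n + 1) ≃ₗ[R]
      (LinearMap.ker (LinearMap.lcomp R N (P.complex.d (n + 2) (n + 1)).hom) ⧸
        (LinearMap.range (LinearMap.lcomp R N (P.complex.d (n + 1) n).hom)).comap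
          (LinearMap.ker (LinearMap.lcomp R N (P.complex.d (n + 2) (n + 1)).hom)).subtype) :=
  (P.isoExt (R := R) (n + 1) (ModuleCat.of R N)).toLinearEquiv ≪≫ₗ
    ((P.complex.linearYonedaObj R (ModuleCat.of R N)).homologyIsoSc' n (n + 1) (n + 2)
      (by simp) (by simp)).toLinearEquiv ≪≫ₗ
    homologyEquivAux _ _ _ ModuleCat.homLinearEquiv ModuleCat.homLinearEquiv
      ModuleCat.homLinearEquiv (fun _ => rfl) (fun _ => rfl)

lemma pd_ses {X Y : Type} [AddCommGroup X] [Module R X] [AddCommGroup Y] [Module R Y]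
    (φ : X →ₗ[R] Y) (hφ : Function.Surjective φ) (hX : Module.Projective R X) (r : ℕ)
    (h : HasProjectiveDimensionLT (ModuleCat.of R (LinearMap.ker φ)) (r + 1)) :
    HasProjectiveDimensionLT (ModuleCat.of R Y) (r + 2) := by
  let S : ShortComplex (ModuleCat R) := ShortComplex.mk
    (ModuleCat.ofHom (LinearMap.ker φ).subtype) (ModuleCat.ofHom φ)
    (ModuleCat.hom_ext (LinearMap.ext fun (x : LinearMap.ker φ) => x.2))
  have hS : S.ShortExact :=
    { exact := by
        rw [ShortComplex.moduleCat_exact_iff]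
        intro x hx
        exact ⟨⟨x, hx⟩, rfl⟩
      mono_f := by
        rw [ModuleCat.mono_iff_injective]
        exact Subtype.val_injective
      epi_g := by
        rw [ModuleCat.epi_iff_surjective]
        exact hφ }
  have hp : Projective S.X₂ := (IsProjective.iff_projective _).1 hX
  exact (hS.hasProjectiveDimensionLT_X₃_iff r hp).2 h

lemma pd_of_ext (n : ℕ) (h : ∀ (L : Type) [AddCommGroup L] [Module R L], ∀ i : ℕ, n < i →
      Subsingleton (extAP R M L i)) :
    ∃ m, HasProjectiveDimensionLT (ModuleCat.of R M) (m + 1) := by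
  let P : ProjectiveResolution (ModuleCat.of R M) := ProjectiveResolution.of (ModuleCat.of R M)
  have hP : ∀ k, Module.Projective R (P.complex.X k) := fun k =>
    (IsProjective.iff_projective _).2 (P.projective k)
  let d : ∀ k, P.complex.X (k + 1) →ₗ[R] P.complex.X k := fun k => (P.complex.d (k + 1) k).hom
  have hd : ∀ k, LinearMap.range (d (k + 1)) = LinearMap.ker (d k) := fun k =>
    (ShortComplex.moduleCat_exact_iff_range_eq_ker _).1 (P.exact_succ k)
  have hΩ : Module.Projective R (LinearMap.range (d n)) := by
    have h1 := h (LinearMap.range (d n)) (n + 1) (by omega)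
    have h2 := (extEquiv (N := LinearMap.range (d n)) P n).symm.injective.subsingleton
    let δ := (d n).rangeRestrict
    have h3 : δ ∈ LinearMap.ker (LinearMap.lcomp R (LinearMap.range (d n)) (d (n + 1))) := by
      rw [LinearMap.mem_ker]
      ext x
      have : d (n + 1) x ∈ LinearMap.ker (d n) := hd n ▸ ⟨x, rfl⟩
      exact this
    have h4 := (Submodule.Quotient.mk_eq_zero _).1 (h2.elim (Submodule.Quotient.mk ⟨δ, h3⟩) 0)
    obtain ⟨g, hg⟩ := h4
    have := hP n
    refine Module.Projective.of_split (LinearMap.range (d n)).subtype g ?_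
    ext ⟨_, x, rfl⟩
    exact congrArg Subtype.val (LinearMap.congr_fun hg x)
  have key : ∀ r k, k + r = n →
      HasProjectiveDimensionLT (ModuleCat.of R (LinearMap.range (d k))) (r + 1) := by
    intro r
    induction r with
    | zero =>
      rintro k rfl
      exact (projective_iff_hasProjectiveDimensionLT_one
        (X := ModuleCat.of R (LinearMap.range (d k)))).1 ((IsProjective.iff_projective _).1 hΩ)
    | succ r ih =>
      intro k hk
      have h1 := ih (k + 1) (by omega)
      rw [hd k] at h1
      refine pd_ses (d k).rangeRestrict (d k).surjective_rangeRestrict (hP _) r ?_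
      rw [LinearMap.ker_rangeRestrict]
      exact h1
  refine ⟨n + 1, ?_⟩
  have h0 := key n 0 (by omega)
  have h5 : LinearMap.range (d 0) = LinearMap.ker (P.π.f 0).hom :=
    (ShortComplex.moduleCat_exact_iff_range_eq_ker _).1 P.exact₀
  rw [h5] at h0
  exact pd_ses (P.π.f 0).hom ((ModuleCat.epi_iff_surjective _).1 inferInstance) (hP 0) n h0
end extcomp

-- Part 5

section mkres
variable {R : Type} [CommRing R] {M : Type} [AddCommGroup M] [Module R M]

/-- concrete projective resolution -/
structure CRes (R : Type) [CommRing R] (M : Type) [AddCommGroup M] [Module R M] where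
  P : ℕ → Type
  [ag : ∀ n, AddCommGroup (P n)]
  [mod : ∀ n, Module R (P n)]
  proj : ∀ n, Module.Projective R (P n)
  fin : ∀ n, Module.Finite R (P n)
  d : ∀ n, P (n + 1) →ₗ[R] P n
  ε : P 0 →ₗ[R] M
  ex : ∀ n, LinearMap.range (d (n + 1)) = LinearMap.ker (d n)
  ex₀ : LinearMap.range (d 0) = LinearMap.ker ε
  surj : Function.Surjective ε

attribute [instance] CRes.ag CRes.mod CRes.proj CRes.fin

namespace CRes

lemma dd (C : CRes R M) (n : ℕ) : C.d n ∘ₗ C.d (n + 1) = 0 :=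
  LinearMap.range_le_ker_iff.1 (C.ex n).le

noncomputable def cplx (C : CRes R M) : ChainComplex (ModuleCat R) ℕ :=
  ChainComplex.of (fun n => ModuleCat.of R (C.P n)) (fun n => ModuleCat.ofHom (C.d n))
    (fun n => by
      rw [← ModuleCat.ofHom_comp, C.dd]; rfl)

lemma cplx_d (C : CRes R M) (n : ℕ) : C.cplx.d (n + 1) n = ModuleCat.ofHom (C.d n) :=
  ChainComplex.of_d (fun n => ModuleCat.of R (C.P n)) (fun n => ModuleCat.ofHom (C.d n)) n

lemma cplx_exact (C : CRes R M) (n : ℕ) : C.cplx.ExactAt (n + 1) := by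
  rw [HomologicalComplex.exactAt_iff' _ (n + 2) (n + 1) n (by simp) (by simp)]
  rw [ShortComplex.moduleCat_exact_iff_range_eq_ker]
  change LinearMap.range (C.cplx.d (n + 2) (n + 1)).hom = LinearMap.ker (C.cplx.d (n + 1) n).hom
  rw [C.cplx_d, C.cplx_d]
  exact C.ex n

noncomputable def aug (C : CRes R M) :
    C.cplx ⟶ (ChainComplex.single₀ (ModuleCat R)).obj (ModuleCat.of R M) :=
  (ChainComplex.toSingle₀Equiv _ _).symm ⟨ModuleCat.ofHom C.ε, by
    rw [C.cplx_d]
    apply ModuleCat.hom_ext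
    exact LinearMap.range_le_ker_iff.1 C.ex₀.le⟩

lemma aug_f (C : CRes R M) : C.aug.f 0 = ModuleCat.ofHom C.ε :=
  ChainComplex.toSingle₀Equiv_symm_apply_f_zero _ _

noncomputable def res (C : CRes R M) : ProjectiveResolution (ModuleCat.of R M) where
  complex := C.cplx
  projective n := (IsProjective.iff_projective _).1 (C.proj n)
  π := C.aug
  quasiIso := ⟨fun n => by
    cases n
    · rw [ChainComplex.quasiIsoAt₀_iff, ShortComplex.quasiIso_iff_of_zeros']
      · constructor
        · rw [ShortComplex.moduleCat_exact_iff_range_eq_ker]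
          change LinearMap.range (C.cplx.d 1 0).hom = LinearMap.ker (C.aug.f 0).hom
          rw [C.aug_f, C.cplx_d]
          exact C.ex₀
        · rw [ModuleCat.epi_iff_surjective]
          exact C.surj
      all_goals rfl
    · rw [quasiIsoAt_iff_exactAt']
      · apply C.cplx_exact
      · apply ChainComplex.exactAt_succ_single_obj⟩

abbrev pre (C : CRes R M) (N : Type) [AddCommGroup N] [Module R N] (n : ℕ) :
    (C.P n →ₗ[R] N) →ₗ[R] (C.P (n + 1) →ₗ[R] N) := LinearMap.lcomp R N (C.d n)

lemma extEq (C : CRes R M) (N : Type) [AddCommGroup N] [Module R N] (n : ℕ) :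
    Nonempty (extAP R M N (n + 1) ≃ₗ[R] (LinearMap.ker (C.pre N (n + 1)) ⧸
      (LinearMap.range (C.pre N n)).comap (LinearMap.ker (C.pre N (n + 1))).subtype)) := by
  have e := extEquiv (N := N) C.res n
  have h : ∀ n, C.res.complex.d (n + 1) n = ModuleCat.ofHom (C.d n) := C.cplx_d
  rw [h n, h (n + 1)] at e
  exact ⟨e⟩

end CRes
end mkres

-- Part 6
open CategoryTheory TensorProduct

section bc
variable {Q A : Type} [CommRing Q] [CommRing A] [Algebra Q A]

lemma one_tmul_surj (hsurj : Function.Surjective (algebraMap Q A)) {N : Type} [AddCommGroup N]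
    [Module Q N] (z : A ⊗[Q] N) : ∃ x : N, (1 : A) ⊗ₜ[Q] x = z := by
  induction z with
  | zero => exact ⟨0, by simp⟩
  | tmul a x =>
    obtain ⟨q, rfl⟩ := hsurj a
    refine ⟨q • x, ?_⟩
    rw [TensorProduct.tmul_smul, TensorProduct.smul_tmul', Algebra.algebraMap_eq_smul_one]
  | add x y hx hy =>
    obtain ⟨a, rfl⟩ := hx
    obtain ⟨b, rfl⟩ := hy
    exact ⟨a + b, by rw [TensorProduct.tmul_add]⟩

lemma one_tmul_eq_zero (hsurj : Function.Surjective (algebraMap Q A)) {N : Type} [AddCommGroup N]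
    [Module Q N] (x : N) :
    (1 : A) ⊗ₜ[Q] x = 0 ↔ x ∈ RingHom.ker (algebraMap Q A) • (⊤ : Submodule Q N) := by
  have hs : Function.Surjective (Algebra.ofId Q A) := hsurj
  let e1 : (Q ⧸ RingHom.ker (Algebra.ofId Q A)) ≃ₐ[Q] A := Ideal.quotientKerAlgEquivOfSurjective hs
  let e2 := TensorProduct.congr e1.symm.toLinearEquiv (LinearEquiv.refl Q N)
  let e3 := TensorProduct.quotTensorEquivQuotSMul N (RingHom.ker (Algebra.ofId Q A))
  have h : e3 (e2 ((1 : A) ⊗ₜ[Q] x)) = Submodule.Quotient.mk x := by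
    have h1 : e2 ((1 : A) ⊗ₜ[Q] x) = (Ideal.Quotient.mk _ (1 : Q)) ⊗ₜ x := by
      change (e1.symm 1) ⊗ₜ[Q] x = _
      rw [map_one]; rfl
    rw [h1]
    have := TensorProduct.quotTensorEquivQuotSMul_mk_tmul (RingHom.ker (Algebra.ofId Q A)) (1 : Q) x
    rw [one_smul] at this
    exact this
  have h2 : (1 : A) ⊗ₜ[Q] x = 0 ↔ (Submodule.Quotient.mk x :
      N ⧸ (RingHom.ker (Algebra.ofId Q A) • (⊤ : Submodule Q N))) = 0 := by
    rw [← h]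
    simp only [LinearEquiv.map_eq_zero_iff]
  rw [h2, Submodule.Quotient.mk_eq_zero]
  rfl
end bc

/-- A resolution with Eisenbud operators -/
structure OpRes (A : Type) [CommRing A] (M : Type) [AddCommGroup M] [Module A M] (c : ℕ)
    extends CRes A M where
  t : Fin c → ∀ n, P (n + 2) →ₗ[A] P n
  s : Fin c → ∀ n, P n →ₗ[A] P (n + 2)
  td : ∀ l n, d n ∘ₗ t l (n + 1) = t l n ∘ₗ d (n + 2)
  tt : ∀ l k n, t l n ∘ₗ t k (n + 2) = t k n ∘ₗ t l (n + 2)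
  i1 : ℕ
  st : ∀ n ≥ i1, ∑ l, s l n ∘ₗ t l n = LinearMap.id

namespace Stage
variable {Q : Type} [CommRing Q] {f : ℕ → Q} {c : ℕ} {M : Type} [AddCommGroup M]
    [Module Q M]

def D (S : Stage f c M c) (n : ℕ) : S.gr ((n + 1 : ℕ) : ℤ) →ₗ[Q] S.gr (n : ℤ) :=
  LinearMap.restrict S.d fun x hx => by
    have := S.d_mem _ _ hx
    rwa [show ((n + 1 : ℕ) : ℤ) - 1 = n by push_cast; ring] at this

def T (S : Stage f c M c) (l : Fin c) (n : ℕ) : S.gr ((n + 2 : ℕ) : ℤ) →ₗ[Q] S.gr (n : ℤ) :=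
  LinearMap.restrict (S.t l) fun x hx => by
    have := S.t_mem l l.2 _ _ hx
    rwa [show ((n + 2 : ℕ) : ℤ) - 2 = n by push_cast; ring] at this

def Ss (S : Stage f c M c) (l : Fin c) (n : ℕ) : S.gr (n : ℤ) →ₗ[Q] S.gr ((n + 2 : ℕ) : ℤ) :=
  LinearMap.restrict (S.s l) fun x hx => by
    have := S.s_mem l l.2 _ _ hx
    rwa [show (n : ℤ) + 2 = ((n + 2 : ℕ) : ℤ) by push_cast; ring] at this

def E0 (S : Stage f c M c) : S.gr ((0 : ℕ) : ℤ) →ₗ[Q] M := S.ε ∘ₗ (S.gr ((0 : ℕ) : ℤ)).subtype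

lemma TD (S : Stage f c M c) (l : Fin c) (n : ℕ) : S.D n ∘ₗ S.T l (n + 1) = S.T l n ∘ₗ S.D (n + 2) := by
  apply LinearMap.ext
  intro x
  apply Subtype.ext
  exact (S.td l l.2 x.1).symm

lemma TT (S : Stage f c M c) (l k : Fin c) (n : ℕ) :
    S.T l n ∘ₗ S.T k (n + 2) = S.T k n ∘ₗ S.T l (n + 2) := by
  apply LinearMap.ext
  intro x
  apply Subtype.ext
  exact S.tt l l.2 k k.2 x.1

lemma ST (S : Stage f c M c) : ∃ i1 : ℕ, ∀ n ≥ i1, ∑ l, S.Ss l n ∘ₗ S.T l n = LinearMap.id := by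
  obtain ⟨i1, h⟩ := S.st
  refine ⟨i1.toNat, fun n hn => ?_⟩
  apply LinearMap.ext
  intro x
  apply Subtype.ext
  have := h n (by omega) x.1 (by
    rw [show (n : ℤ) + 2 = ((n + 2 : ℕ) : ℤ) by push_cast; ring]
    exact x.2)
  rw [Finset.sum_range] at this
  rw [LinearMap.sum_apply, AddSubmonoidClass.coe_finsetSum]
  exact this

lemma DD (S : Stage f c M c) (n : ℕ) (x) :
    S.D n (S.D (n + 1) x) = ∑ i : Fin c, f i • S.T i n x := by
  apply Subtype.ext
  have := S.dd x.1
  rw [Finset.sum_range] at this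
  rw [AddSubmonoidClass.coe_finsetSum]
  exact this

lemma smul_top_iff {X : Type} [AddCommGroup X] [Module Q X] (N : Submodule Q X) (J : Ideal Q)
    (x : N) : x ∈ J • (⊤ : Submodule Q N) ↔ x.1 ∈ J • N := by
  have h : (J • (⊤ : Submodule Q N)).map N.subtype = J • N := by
    rw [Submodule.map_smul'', Submodule.map_subtype_top]
  rw [← h]
  constructor
  · intro hx; exact ⟨x, hx, rfl⟩
  · rintro ⟨y, hy, h⟩
    have : y = x := Subtype.ext h
    rwa [← this]

lemma Dex (S : Stage f c M c) (n : ℕ) (x) (h : S.D n x ∈ Jd f c • (⊤ : Submodule Q _)) :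
    ∃ y, x - S.D (n + 1) y ∈ Jd f c • (⊤ : Submodule Q _) := by
  rw [smul_top_iff] at h
  obtain ⟨y, hy, h1⟩ := S.ex ((n + 1 : ℕ) : ℤ) (by push_cast; omega) x.1 x.2 (by
    rw [show ((n + 1 : ℕ) : ℤ) - 1 = n by push_cast; ring]
    exact h)
  rw [show ((n + 1 : ℕ) : ℤ) + 1 = ((n + 1 + 1 : ℕ) : ℤ) by push_cast; ring] at hy
  refine ⟨⟨y, hy⟩, ?_⟩
  rw [smul_top_iff]
  exact h1

lemma E0D (S : Stage f c M c) (x) : S.E0 (S.D 0 x) = 0 := S.ε_d x.1 (by simp)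

lemma E0ex (S : Stage f c M c) (x) (h : S.E0 x = 0) :
    ∃ y, x - S.D 0 y ∈ Jd f c • (⊤ : Submodule Q _) := by
  obtain ⟨y, hy, h1⟩ := S.ε_ex x.1 (by simp) h
  refine ⟨⟨y, by simpa using hy⟩, ?_⟩
  rw [smul_top_iff]
  exact h1

variable {A : Type} [CommRing A] [Algebra Q A] [Module A M] [IsScalarTower Q A M]

noncomputable def toOpRes (S : Stage f c M c) (hsurj : Function.Surjective (algebraMap Q A))
    (hker : RingHom.ker (algebraMap Q A) = Jd f c) : OpRes A M c where
  P n := A ⊗[Q] S.gr (n : ℤ)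
  proj n := by
    have := S.proj n
    infer_instance
  fin n := by
    have := S.fg n
    infer_instance
  d n := (S.D n).baseChange A
  ε := S.E0.liftBaseChange A
  ex n := by
    ext z
    obtain ⟨x, rfl⟩ := one_tmul_surj hsurj z
    rw [LinearMap.mem_ker, LinearMap.baseChange_tmul]
    constructor
    · rintro ⟨w, hw⟩
      obtain ⟨y, rfl⟩ := one_tmul_surj hsurj w
      rw [LinearMap.baseChange_tmul] at hw
      have h1 := congrArg ((S.D n).baseChange A) hw
      rw [LinearMap.baseChange_tmul, LinearMap.baseChange_tmul] at h1
      rw [← h1, one_tmul_eq_zero hsurj, hker, S.DD]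
      exact Submodule.sum_mem _ fun i _ =>
        Submodule.smul_mem_smul (mem_Jd f i.2) Submodule.mem_top
    · intro h
      rw [one_tmul_eq_zero hsurj, hker] at h
      obtain ⟨y, hy⟩ := S.Dex n x h
      rw [← hker, ← one_tmul_eq_zero hsurj, TensorProduct.tmul_sub, sub_eq_zero] at hy
      exact ⟨1 ⊗ₜ y, by rw [LinearMap.baseChange_tmul]; exact hy.symm⟩
  ex₀ := by
    ext z
    obtain ⟨x, rfl⟩ := one_tmul_surj hsurj z
    rw [LinearMap.mem_ker, LinearMap.liftBaseChange_tmul, one_smul]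
    constructor
    · rintro ⟨w, hw⟩
      obtain ⟨y, rfl⟩ := one_tmul_surj hsurj w
      have h1 := congrArg (S.E0.liftBaseChange A) hw
      rw [LinearMap.baseChange_tmul, LinearMap.liftBaseChange_tmul,
        LinearMap.liftBaseChange_tmul, one_smul, one_smul, S.E0D] at h1
      exact h1.symm
    · intro h
      obtain ⟨y, hy⟩ := S.E0ex x h
      rw [← hker, ← one_tmul_eq_zero hsurj, TensorProduct.tmul_sub, sub_eq_zero] at hy
      exact ⟨1 ⊗ₜ y, by rw [LinearMap.baseChange_tmul]; exact hy.symm⟩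
  surj m := by
    obtain ⟨x, hx, h⟩ := S.ε_surj m
    refine ⟨1 ⊗ₜ ⟨x, by simpa using hx⟩, ?_⟩
    rw [LinearMap.liftBaseChange_tmul, one_smul]
    exact h
  t l n := (S.T l n).baseChange A
  s l n := (S.Ss l n).baseChange A
  td l n := by
    rw [← LinearMap.baseChange_comp, ← LinearMap.baseChange_comp, S.TD]
  tt l k n := by
    rw [← LinearMap.baseChange_comp, ← LinearMap.baseChange_comp, S.TT]
  i1 := S.ST.choose
  st n hn := by
    have := S.ST.choose_spec n hn
    have h2 := congrArg (LinearMap.baseChangeHom Q A _ _) this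
    rw [map_sum] at h2
    have h3 : (LinearMap.baseChangeHom Q A _ _) (LinearMap.id : S.gr ((n + 2 : ℕ) : ℤ) →ₗ[Q] _) = LinearMap.id :=
      LinearMap.baseChange_id
    rw [h3] at h2
    rw [← h2]
    apply Finset.sum_congr rfl
    intro l _
    exact (LinearMap.baseChange_comp _ _).symm
end Stage

-- Part 7

theorem ass_contract {A B T : Type*} [CommRing A] [CommRing B] [Algebra A B] [AddCommGroup T]
    [Module A T] [Module B T] [IsScalarTower A B T] [IsNoetherianRing A] [IsNoetherianRing B]
    [Module.Finite B T] : (associatedPrimes A T).Finite := by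
  have hfin : (associatedPrimes B T).Finite := associatedPrimes.finite B T
  refine (hfin.image (fun q => q.comap (algebraMap A B))).subset ?_
  intro p hp
  obtain ⟨hpp, x, hx⟩ := isAssociatedPrime_iff.1 hp
  have hx' : ∀ a : A, a ∈ p ↔ a • x = 0 := by
    intro a; rw [hx, Submodule.mem_colon_singleton, Submodule.mem_bot]
  let S : Set (Ideal B) := {q | ∃ y : T, q = Submodule.colon ⊥ {y} ∧ (∀ a ∈ p, a • y = 0) ∧
    ∀ a : A, a ∉ p → a • y ≠ 0}
  have hS : S.Nonempty := ⟨_, x, rfl, fun a ha => (hx' a).1 ha, fun a ha h => ha ((hx' a).2 h)⟩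
  obtain ⟨q, ⟨y, hq, hy1, hy2⟩, hmax⟩ := set_has_maximal_iff_noetherian.2 (inferInstance : IsNoetherian B B) S hS
  have hmem : ∀ b : B, b ∈ q ↔ b • y = 0 := by
    intro b; rw [hq, Submodule.mem_colon_singleton, Submodule.mem_bot]
  have hcomap : Ideal.comap (algebraMap A B) q = p := by
    ext a
    rw [Ideal.mem_comap, hmem, algebraMap_smul]
    constructor
    · intro h; by_contra h'; exact hy2 a h' h
    · exact hy1 a
  refine ⟨q, ?_, hcomap⟩
  refine isAssociatedPrime_iff.2 ⟨⟨?_, ?_⟩, y, hq⟩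
  · rintro rfl
    apply hpp.ne_top
    rw [← hcomap]; rfl
  · intro b b' hbb
    by_contra hcon
    push Not at hcon
    obtain ⟨hb, hb'⟩ := hcon
    -- y' = b' • y
    by_cases hc : ∀ a : A, a ∉ p → a • (b' • y) ≠ 0
    · refine hmax (Submodule.colon ⊥ {b' • y}) ⟨b' • y, rfl, ?_, hc⟩ ?_
      · intro a ha
        rw [smul_comm, hy1 a ha, smul_zero]
      · refine lt_of_le_of_ne ?_ ?_
        · intro z hz
          rw [Submodule.mem_colon_singleton, Submodule.mem_bot, smul_comm, (hmem z).1 hz, smul_zero]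
        · intro h
          apply hb
          rw [h, Submodule.mem_colon_singleton, Submodule.mem_bot, ← mul_smul]
          exact (hmem _).1 hbb
    · push Not at hc
      obtain ⟨a, ha, hab⟩ := hc
      refine hmax (Submodule.colon ⊥ {a • y}) ⟨a • y, rfl, ?_, ?_⟩ ?_
      · intro a' ha'
        rw [smul_comm, hy1 a' ha', smul_zero]
      · intro a' ha' h
        rw [← mul_smul] at h
        exact hy2 _ (fun h' => (hpp.mem_or_mem h').elim ha' ha) h
      · refine lt_of_le_of_ne ?_ ?_
        · intro z hz
          rw [Submodule.mem_colon_singleton, Submodule.mem_bot, smul_comm, (hmem z).1 hz, smul_zero]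
        · intro h
          apply hb'
          rw [h, Submodule.mem_colon_singleton, Submodule.mem_bot, smul_comm]
          exact hab

open scoped IsMulCommutative in
theorem ops_lemma {A T : Type*} [CommRing A] [AddCommGroup T] [Module A T] [IsNoetherianRing A]
    (s : Set (Module.End A T)) (hs : s.Finite) (hcomm : ∀ a ∈ s, ∀ b ∈ s, a * b = b * a)
    (G : Set T) (hG : G.Finite)
    (hgen : ∀ N : Submodule A T, G ⊆ N → (∀ u ∈ s, ∀ x ∈ N, u x ∈ N) → N = ⊤) :
    (associatedPrimes A T).Finite ∧
    ∀ Z : ℕ →o Submodule A T, (∀ k, ∀ u ∈ s, ∀ x ∈ Z k, u x ∈ Z k) →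
      ∃ k0, ∀ k ≥ k0, Z k0 = Z k := by
  have := Algebra.isMulCommutative_adjoin A hcomm
  have hft : Algebra.FiniteType A (Algebra.adjoin A s) :=
    (Subalgebra.fg_iff_finiteType _).1 (Subalgebra.fg_def.2 ⟨s, hs, rfl⟩)
  have hBN : IsNoetherianRing (Algebra.adjoin A s) := Algebra.FiniteType.isNoetherianRing A _
  have htow : IsScalarTower A (Algebra.adjoin A s) T := inferInstance
  have hfin : Module.Finite (Algebra.adjoin A s) T := by
    refine ⟨⟨hG.toFinset, ?_⟩⟩
    rw [hG.coe_toFinset]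
    have := hgen ((Submodule.span (Algebra.adjoin A s) G).restrictScalars A)
      (fun x hx => Submodule.subset_span hx) ?_
    · exact (Submodule.restrictScalars_eq_top_iff A _ T).1 this
    · intro u hu x hx
      exact Submodule.smul_mem _ (⟨u, Algebra.subset_adjoin hu⟩ : Algebra.adjoin A s) hx
  refine ⟨ass_contract (A := A) (B := Algebra.adjoin A s) (T := T), ?_⟩
  intro Z hZ
  have hstab : ∀ k, ∀ b ∈ Algebra.adjoin A s, ∀ x ∈ Z k, b x ∈ Z k := by
    intro k b hb
    induction hb using Algebra.adjoin_induction with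
    | mem u hu => exact hZ k u hu
    | algebraMap r => intro x hx; exact (Z k).smul_mem r hx
    | add x y _ _ h1 h2 => intro z hz; exact (Z k).add_mem (h1 z hz) (h2 z hz)
    | mul x y _ _ h1 h2 => intro z hz; exact h1 _ (h2 z hz)
  let Z' : ℕ →o Submodule (Algebra.adjoin A s) T :=
    { toFun := fun k =>
        { carrier := Z k
          add_mem' := fun h1 h2 => (Z k).add_mem h1 h2
          zero_mem' := (Z k).zero_mem
          smul_mem' := fun b x hx => hstab k b.1 b.2 x hx }
      monotone' := fun k l h x hx => Z.monotone h hx }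
  have : IsNoetherian (Algebra.adjoin A s) T := isNoetherian_of_isNoetherianRing_of_finite _ _
  obtain ⟨k0, h⟩ := monotone_stabilizes_iff_noetherian.2 this Z'
  refine ⟨k0, fun k hk => ?_⟩
  ext x
  have := h k hk
  have h2 : x ∈ Z' k0 ↔ x ∈ Z' k := by rw [this]
  exact h2

-- Part 8

/-- A bigraded family of modules with two finite families of commuting operators. -/
structure Fam (A : Type) [CommRing A] (c r : ℕ) where
  E : ℕ → ℕ → Type
  ag : ∀ i n, AddCommGroup (E i n)
  mod : ∀ i n, Module A (E i n)
  t : Fin c → ∀ i n, E i n →ₗ[A] E (i+1) n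
  a : Fin r → ∀ i n, E i n →ₗ[A] E i (n+1)
  tt : ∀ l k i n (x : E i n), t l (i+1) n (t k i n x) = t k (i+1) n (t l i n x)
  aa : ∀ l k i n (x : E i n), a l i (n+1) (a k i n x) = a k i (n+1) (a l i n x)
  ta : ∀ l k i n (x : E i n), t l i (n+1) (a k i n x) = a k (i+1) n (t l i n x)

namespace Fam
variable {A : Type} [CommRing A] {c r : ℕ} (F : Fam A c r)

instance (i n) : AddCommGroup (F.E i n) := F.ag i n
instance (i n) : Module A (F.E i n) := F.mod i n

/-- exchange the two gradings -/
def swap : Fam A r c where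
  E i n := F.E n i
  ag i n := F.ag n i
  mod i n := F.mod n i
  t l i n := F.a l n i
  a l i n := F.t l n i
  tt l k i n x := F.aa l k n i x
  aa l k i n x := F.tt l k n i x
  ta l k i n x := (F.ta k l n i x).symm

/-- shift the two gradings -/
def shift (i0 n0 : ℕ) : Fam A c r where
  E i n := F.E (i0 + i) (n0 + n)
  ag i n := F.ag _ _
  mod i n := F.mod _ _
  t l i n := F.t l (i0 + i) (n0 + n)
  a l i n := F.a l (i0 + i) (n0 + n)
  tt l k i n x := F.tt l k _ _ x
  aa l k i n x := F.aa l k _ _ x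
  ta l k i n x := F.ta l k _ _ x

def Stable (Z : ∀ i n, Submodule A (F.E i n)) : Prop :=
  (∀ l i n, ∀ x ∈ Z i n, F.t l i n x ∈ Z (i+1) n) ∧
  (∀ l i n, ∀ x ∈ Z i n, F.a l i n x ∈ Z i (n+1))

/-- sub-family generated in the t-direction -/
def tspan (Z : ∀ i n, Submodule A (F.E i n)) : ∀ i n, Submodule A (F.E i n)
  | 0, _ => ⊥
  | i+1, n => ⨆ l, (Z i n).map (F.t l i n)

def aspan (Z : ∀ i n, Submodule A (F.E i n)) : ∀ i n, Submodule A (F.E i n)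
  | _, 0 => ⊥
  | i, n+1 => ⨆ l, (Z i n).map (F.a l i n)

def Acc : Prop := ∀ Z : ℕ → ∀ i n, Submodule A (F.E i n), (∀ k, F.Stable (Z k)) →
  (∀ k l, k ≤ l → ∀ i n, Z k i n ≤ Z l i n) → ∃ k0, ∀ k ≥ k0, ∀ i n, Z k0 i n = Z k i n

theorem Acc.swap {F : Fam A c r} (h : F.Acc) : F.swap.Acc := by
  intro Z hZ hm
  obtain ⟨k0, h0⟩ := h (fun k i n => Z k n i) (fun k => ⟨fun l i n x hx => (hZ k).2 l n i x hx,
    fun l i n x hx => (hZ k).1 l n i x hx⟩) (fun k l hkl i n => hm k l hkl n i)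
  exact ⟨k0, fun k hk i n => h0 k hk n i⟩

theorem tspan_le {Z : ∀ i n, Submodule A (F.E i n)} (hZ : F.Stable Z) (i n) :
    F.tspan Z i n ≤ Z i n := by
  cases i with
  | zero => exact bot_le
  | succ i =>
    refine iSup_le fun l => ?_
    rintro _ ⟨x, hx, rfl⟩
    exact hZ.1 l i n x hx

theorem mem_tspan {Z : ∀ i n, Submodule A (F.E i n)} (l i n) {x} (hx : x ∈ Z i n) :
    F.t l i n x ∈ F.tspan Z (i+1) n :=
  (le_iSup (fun l => (Z i n).map (F.t l i n)) l) ⟨x, hx, rfl⟩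

theorem Acc.tgen {F : Fam A c r} (h : F.Acc) {Z : ∀ i n, Submodule A (F.E i n)}
    (hZ : F.Stable Z) : ∃ i2, ∀ i ≥ i2, ∀ n, Z (i+1) n = ⨆ l, (Z i n).map (F.t l i n) := by
  have hle := F.tspan_le hZ
  have hstab : ∀ k, F.Stable (fun i n => if i ≤ k then Z i n else F.tspan Z i n) := by
    intro k
    have hle' : ∀ i n, (if i ≤ k then Z i n else F.tspan Z i n) ≤ Z i n := by
      intro i n; split_ifs
      · exact le_rfl
      · exact hle i n
    have hge' : ∀ i n, F.tspan Z i n ≤ (if i ≤ k then Z i n else F.tspan Z i n) := by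
      intro i n; split_ifs
      · exact hle i n
      · exact le_rfl
    constructor
    · intro l i n x hx
      exact hge' _ _ (F.mem_tspan l i n (hle' i n hx))
    · intro l i n x hx
      dsimp only at hx ⊢
      split_ifs with hik
      · rw [if_pos hik] at hx
        exact hZ.2 l i n x hx
      · rw [if_neg hik] at hx
        cases i with
        | zero => omega
        | succ i =>
          have : F.tspan Z (i+1) n ≤ (F.tspan Z (i+1) (n+1)).comap (F.a l (i+1) n) := by
            refine iSup_le fun m => ?_
            rintro _ ⟨y, hy, rfl⟩
            change F.a l (i+1) n (F.t m i n y) ∈ F.tspan Z (i+1) (n+1)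
            rw [← F.ta]
            exact F.mem_tspan m i (n+1) (hZ.2 l i n y hy)
          exact this hx
  have hmono : ∀ k l, k ≤ l → ∀ i n, (if i ≤ k then Z i n else F.tspan Z i n) ≤
      (if i ≤ l then Z i n else F.tspan Z i n) := by
    intro k l hkl i n
    split_ifs with h1 h2 h2
    · exact le_rfl
    · omega
    · exact hle i n
    · exact le_rfl
  obtain ⟨k0, h0⟩ := h (fun k i n => if i ≤ k then Z i n else F.tspan Z i n) hstab hmono
  refine ⟨k0, fun i hi n => ?_⟩
  have := h0 (i+1) (by omega) (i+1) n
  simp only [le_refl, if_true] at this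
  rw [if_neg (by omega)] at this
  exact this.symm

theorem Acc.agen {F : Fam A c r} (h : F.Acc) {Z : ∀ i n, Submodule A (F.E i n)}
    (hZ : F.Stable Z) : ∃ n2, ∀ n ≥ n2, ∀ i, Z i (n+1) = ⨆ l, (Z i n).map (F.a l i n) := by
  have : F.swap.Stable (fun i n => Z n i) := ⟨fun l i n x hx => hZ.2 l n i x hx,
    fun l i n x hx => hZ.1 l n i x hx⟩
  exact h.swap.tgen this

theorem mem_ass_iff {R N : Type*} [CommRing R] [IsNoetherianRing R] [AddCommGroup N] [Module R N]
    (p : Ideal R) [hp : p.IsPrime] :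
    p ∈ associatedPrimes R N ↔ ∃ x : N, (∀ a ∈ p, a • x = 0) ∧ ∀ a : R, a ∉ p → a • x ≠ 0 := by
  constructor
  · intro h
    obtain ⟨_, x, hx⟩ := isAssociatedPrime_iff.1 h
    have hx' : ∀ a, a ∈ p ↔ a • x = 0 := by
      intro a; rw [hx, Submodule.mem_colon_singleton, Submodule.mem_bot]
    exact ⟨x, fun a ha => (hx' a).1 ha, fun a ha h => ha ((hx' a).2 h)⟩
  · rintro ⟨x, h1, h2⟩
    refine isAssociatedPrime_iff.2 ⟨hp, x, ?_⟩
    ext a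
    rw [Submodule.mem_colon_singleton, Submodule.mem_bot]
    exact ⟨h1 a, fun h => by by_contra h'; exact h2 a h' h⟩

/-- elements killed by the prime and by something outside it -/
def U (p : Ideal A) [hp : p.IsPrime] (i n) : Submodule A (F.E i n) where
  carrier := {x | ∃ s, s ∉ p ∧ s • x = 0}
  add_mem' := by
    rintro x y ⟨s, hs, hx⟩ ⟨s', hs', hy⟩
    refine ⟨s * s', fun h => (hp.mem_or_mem h).elim hs hs', ?_⟩
    rw [smul_add, mul_smul, mul_smul, hy, smul_zero, smul_comm, hx, smul_zero, add_zero]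
  zero_mem' := ⟨1, fun h => hp.ne_top ((Ideal.eq_top_iff_one p).2 h), smul_zero _⟩
  smul_mem' := by
    rintro a x ⟨s, hs, hx⟩
    exact ⟨s, hs, by rw [smul_comm, hx, smul_zero]⟩

def V (p : Ideal A) (i n) : Submodule A (F.E i n) where
  carrier := {x | ∀ s ∈ p, s • x = 0}
  add_mem' := by
    intro x y hx hy s hs
    rw [smul_add, hx s hs, hy s hs, add_zero]
  zero_mem' := fun s _ => smul_zero _
  smul_mem' := by
    intro a x hx s hs
    rw [smul_comm, hx s hs, smul_zero]

theorem Vstable (p : Ideal A) : F.Stable (F.V p) := by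
  constructor
  · intro l i n x hx s hs
    rw [← map_smul, hx s hs, map_zero]
  · intro l i n x hx s hs
    rw [← map_smul, hx s hs, map_zero]

theorem Ustable (p : Ideal A) [p.IsPrime] : F.Stable (F.U p) := by
  constructor
  · rintro l i n x ⟨s, hs, hx⟩
    exact ⟨s, hs, by rw [← map_smul, hx, map_zero]⟩
  · rintro l i n x ⟨s, hs, hx⟩
    exact ⟨s, hs, by rw [← map_smul, hx, map_zero]⟩

theorem ass_iff_VU [IsNoetherianRing A] (p : Ideal A) [p.IsPrime] (i n) :
    p ∉ associatedPrimes A (F.E i n) ↔ F.V p i n ≤ F.U p i n := by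
  rw [mem_ass_iff]
  push Not
  constructor
  · intro h x hx
    exact h x hx
  · intro h x hx
    exact h hx

theorem Acc.dich [IsNoetherianRing A] {F : Fam A c r} (h : F.Acc) (p : Ideal A) [p.IsPrime] :
    ∃ N, ∀ i ≥ N, ∀ n ≥ N,
      (p ∈ associatedPrimes A (F.E i n) ↔ p ∈ associatedPrimes A (F.E N N)) := by
  obtain ⟨i2, hi2⟩ := h.tgen (F.Vstable p)
  obtain ⟨n2, hn2⟩ := h.agen (F.Vstable p)
  have hU := F.Ustable p
  have key : ∀ i ≥ i2, ∀ n ≥ n2, F.V p i n ≤ F.U p i n → ∀ k m,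
      F.V p (i+k) (n+m) ≤ F.U p (i+k) (n+m) := by
    intro i hi n hn h0 k m
    induction k with
    | zero =>
      induction m with
      | zero => exact h0
      | succ m ih =>
        rw [← add_assoc, hn2 (n+m) (by omega) (i+0)]
        refine iSup_le fun l => ?_
        rintro _ ⟨x, hx, rfl⟩
        exact hU.2 l _ _ x (ih hx)
    | succ k ih =>
        rw [← add_assoc, hi2 (i+k) (by omega)]
        refine iSup_le fun l => ?_
        rintro _ ⟨x, hx, rfl⟩
        exact hU.1 l _ _ x (ih hx)
  by_cases hex : ∃ i ≥ i2, ∃ n ≥ n2, p ∉ associatedPrimes A (F.E i n)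
  · obtain ⟨i, hi, n, hn, hp⟩ := hex
    rw [ass_iff_VU] at hp
    have hall : ∀ i' ≥ i, ∀ n' ≥ n, p ∉ associatedPrimes A (F.E i' n') := by
      intro i' hi' n' hn'
      obtain ⟨k, rfl⟩ := Nat.exists_eq_add_of_le hi'
      obtain ⟨m, rfl⟩ := Nat.exists_eq_add_of_le hn'
      rw [ass_iff_VU]
      exact key i hi n hn hp k m
    refine ⟨max i n, fun i' hi' n' hn' => iff_of_false ?_ ?_⟩
    · exact hall _ (le_trans (le_max_left _ _) hi') _ (le_trans (le_max_right _ _) hn')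
    · exact hall _ (le_max_left _ _) _ (le_max_right _ _)
  · push Not at hex
    refine ⟨max i2 n2, fun i' hi' n' hn' => iff_of_true ?_ ?_⟩
    · exact hex _ (le_trans (le_max_left _ _) hi') _ (le_trans (le_max_right _ _) hn')
    · exact hex _ (le_max_left _ _) _ (le_max_right _ _)

theorem Acc.stab [IsNoetherianRing A] {F : Fam A c r} (h : F.Acc) (S : Set (Ideal A))
    (hS : S.Finite) (hsub : ∀ i n, associatedPrimes A (F.E i n) ⊆ S) :
    ∃ N, ∀ i ≥ N, ∀ n ≥ N, associatedPrimes A (F.E i n) = associatedPrimes A (F.E N N) := by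
  have h1 : ∀ p : Ideal A, ∃ N, ∀ i ≥ N, ∀ n ≥ N,
      (p ∈ associatedPrimes A (F.E i n) ↔ p ∈ associatedPrimes A (F.E N N)) := by
    intro p
    by_cases hp : p.IsPrime
    · exact h.dich p
    · exact ⟨0, fun i _ n _ => iff_of_false (fun h => hp h.isPrime) (fun h => hp h.isPrime)⟩
  choose N hN using h1
  refine ⟨hS.toFinset.sup N, fun i hi n hn => ?_⟩
  ext p
  by_cases hp : p ∈ S
  · have hle : N p ≤ hS.toFinset.sup N := Finset.le_sup (hS.mem_toFinset.2 hp)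
    rw [hN p i (le_trans hle hi) n (le_trans hle hn), hN p _ hle _ hle]
  · exact iff_of_false (fun h => hp (hsub _ _ h)) (fun h => hp (hsub _ _ h))

end Fam

-- Part 9

namespace Fam
variable {A : Type} [CommRing A] {c r : ℕ} (F : Fam A c r)

structure Gen : Prop where
  genT : ∀ i n, ⨆ l, LinearMap.range (F.t l i n) = ⊤
  genA : ∀ i n, ⨆ l, LinearMap.range (F.a l i n) = ⊤
  fin : Module.Finite A (F.E 0 0)

abbrev T : Type := DirectSum (ℕ × ℕ) (fun p => F.E p.1 p.2)

abbrev ι (p : ℕ × ℕ) : F.E p.1 p.2 →ₗ[A] F.T := DirectSum.lof A (ℕ × ℕ) (fun p => F.E p.1 p.2) p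

def th (l : Fin c) : F.T →ₗ[A] F.T :=
  DirectSum.toModule A _ _ (fun p => F.ι (p.1+1, p.2) ∘ₗ F.t l p.1 p.2)

def ah (l : Fin r) : F.T →ₗ[A] F.T :=
  DirectSum.toModule A _ _ (fun p => F.ι (p.1, p.2+1) ∘ₗ F.a l p.1 p.2)

theorem th_ι (l) (p : ℕ × ℕ) (x) : F.th l (F.ι p x) = F.ι (p.1+1, p.2) (F.t l p.1 p.2 x) :=
  DirectSum.toModule_lof ..

theorem ah_ι (l) (p : ℕ × ℕ) (x) : F.ah l (F.ι p x) = F.ι (p.1, p.2+1) (F.a l p.1 p.2 x) :=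
  DirectSum.toModule_lof ..

theorem th_th (l k) : F.th l * F.th k = F.th k * F.th l := by
  refine DirectSum.linearMap_ext A fun p => LinearMap.ext fun x => ?_
  change F.th l (F.th k (F.ι p x)) = F.th k (F.th l (F.ι p x))
  rw [th_ι, th_ι, th_ι, th_ι]
  exact congrArg _ (F.tt l k _ _ x)

theorem ah_ah (l k) : F.ah l * F.ah k = F.ah k * F.ah l := by
  refine DirectSum.linearMap_ext A fun p => LinearMap.ext fun x => ?_
  change F.ah l (F.ah k (F.ι p x)) = F.ah k (F.ah l (F.ι p x))
  rw [ah_ι, ah_ι, ah_ι, ah_ι]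
  exact congrArg _ (F.aa l k _ _ x)

theorem th_ah (l k) : F.th l * F.ah k = F.ah k * F.th l := by
  refine DirectSum.linearMap_ext A fun p => LinearMap.ext fun x => ?_
  change F.th l (F.ah k (F.ι p x)) = F.ah k (F.th l (F.ι p x))
  rw [ah_ι, th_ι, th_ι, ah_ι]
  exact congrArg _ (F.ta l k _ _ x)

theorem ι_inj (p) : Function.Injective (F.ι p) := fun x y h => by
  have := congrArg (DirectSum.component A _ _ p) h
  rwa [DirectSum.component.lof_self, DirectSum.component.lof_self] at this

/-- total submodule -/
def tot (Z : ∀ i n, Submodule A (F.E i n)) : Submodule A F.T := ⨆ p, (Z p.1 p.2).map (F.ι p)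

theorem mem_tot (Z : ∀ i n, Submodule A (F.E i n)) (p : ℕ × ℕ) (x) :
    F.ι p x ∈ F.tot Z ↔ x ∈ Z p.1 p.2 := by
  constructor
  · intro h
    have : F.tot Z ≤ (Z p.1 p.2).comap (DirectSum.component A _ _ p) := by
      refine iSup_le fun q => ?_
      rintro _ ⟨z, hz, rfl⟩
      rw [Submodule.mem_comap]
      by_cases hpq : q = p
      · subst hpq
        rw [DirectSum.component.lof_self]; exact hz
      · rw [DirectSum.component.of, dif_neg hpq]
        exact Submodule.zero_mem _
    have h2 := this h
    rwa [Submodule.mem_comap, DirectSum.component.lof_self] at h2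
  · intro h
    exact (le_iSup (fun p : ℕ × ℕ => (Z p.1 p.2).map (F.ι p)) p) ⟨x, h, rfl⟩

theorem Gen.main [IsNoetherianRing A] {F : Fam A c r} (h : F.Gen) :
    (associatedPrimes A F.T).Finite ∧ F.Acc := by
  obtain ⟨G, hG⟩ := h.fin.fg_top
  have hcomm : ∀ a ∈ Set.range F.th ∪ Set.range F.ah, ∀ b ∈ Set.range F.th ∪ Set.range F.ah,
      a * b = b * a := by
    rintro _ (⟨l, rfl⟩ | ⟨l, rfl⟩) _ (⟨k, rfl⟩ | ⟨k, rfl⟩)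
    · exact F.th_th l k
    · exact F.th_ah l k
    · exact (F.th_ah k l).symm
    · exact F.ah_ah l k
  have hgen : ∀ N : Submodule A F.T, F.ι (0,0) '' (G : Set (F.E 0 0)) ⊆ N →
      (∀ u ∈ Set.range F.th ∪ Set.range F.ah, ∀ x ∈ N, u x ∈ N) → N = ⊤ := by
    intro N hGN hst
    have h00 : ∀ i n, N.comap (F.ι (i, n)) = ⊤ := by
      intro i n
      induction i with
      | zero =>
        induction n with
        | zero =>
          rw [eq_top_iff, ← hG, Submodule.span_le]
          intro x hx
          exact hGN ⟨x, hx, rfl⟩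
        | succ n ih =>
          rw [eq_top_iff, ← h.genA]
          refine iSup_le fun l => ?_
          rintro _ ⟨x, rfl⟩
          have hx : x ∈ N.comap (F.ι (0, n)) := ih ▸ trivial
          rw [Submodule.mem_comap]
          have := hst (F.ah l) (Or.inr ⟨l, rfl⟩) _ hx
          rw [ah_ι] at this
          exact this
      | succ i ih =>
          rw [eq_top_iff, ← h.genT]
          refine iSup_le fun l => ?_
          rintro _ ⟨x, rfl⟩
          have hx : x ∈ N.comap (F.ι (i, n)) := ih ▸ trivial
          rw [Submodule.mem_comap]
          have := hst (F.th l) (Or.inl ⟨l, rfl⟩) _ hx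
          rw [th_ι] at this
          exact this
    rw [eq_top_iff]
    rintro x -
    induction x using DirectSum.induction_on with
    | zero => exact N.zero_mem
    | of p x =>
      have : x ∈ N.comap (F.ι (p.1, p.2)) := h00 p.1 p.2 ▸ trivial
      exact this
    | add x y hx hy => exact N.add_mem hx hy
  obtain ⟨h1, h2⟩ := ops_lemma (A := A) (T := F.T) (Set.range F.th ∪ Set.range F.ah)
    ((Set.finite_range _).union (Set.finite_range _)) hcomm (F.ι (0,0) '' (G : Set (F.E 0 0)))
    (G.finite_toSet.image _) hgen
  refine ⟨h1, ?_⟩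
  intro Z hZ hm
  have hst : ∀ k, ∀ u ∈ Set.range F.th ∪ Set.range F.ah, ∀ x ∈ F.tot (Z k), u x ∈ F.tot (Z k) := by
    rintro k u (⟨l, rfl⟩ | ⟨l, rfl⟩)
    · change F.tot (Z k) ≤ (F.tot (Z k)).comap (F.th l)
      refine iSup_le fun p => ?_
      rintro _ ⟨x, hx, rfl⟩
      rw [Submodule.mem_comap, th_ι]
      exact (F.mem_tot (Z k) (p.1+1, p.2) _).2 ((hZ k).1 l _ _ x hx)
    · change F.tot (Z k) ≤ (F.tot (Z k)).comap (F.ah l)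
      refine iSup_le fun p => ?_
      rintro _ ⟨x, hx, rfl⟩
      rw [Submodule.mem_comap, ah_ι]
      exact (F.mem_tot (Z k) (p.1, p.2+1) _).2 ((hZ k).2 l _ _ x hx)
  obtain ⟨k0, h0⟩ := h2 ⟨fun k => F.tot (Z k), fun k l hkl =>
      iSup_mono fun p => Submodule.map_mono (hm k l hkl p.1 p.2)⟩ hst
  refine ⟨k0, fun k hk i n => ?_⟩
  have := h0 k hk
  ext x
  rw [← F.mem_tot (Z k0) (i,n) x, ← F.mem_tot (Z k) (i,n) x]
  exact iff_of_eq (congrArg (F.ι (i,n) x ∈ ·) this)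

theorem Gen.stab [IsNoetherianRing A] {F : Fam A c r} (h : F.Gen) :
    ∃ N, ∀ i ≥ N, ∀ n ≥ N, associatedPrimes A (F.E i n) = associatedPrimes A (F.E N N) :=
  h.main.2.stab _ h.main.1 fun i n => associatedPrimes.subset_of_injective (F.ι_inj (i,n))

/-- eventually generated family -/
theorem stab_of_eventually [IsNoetherianRing A] (i2 n2 : ℕ)
    (hT : ∀ i ≥ i2, ∀ n ≥ n2, ⨆ l, LinearMap.range (F.t l i n) = ⊤)
    (hA : ∀ i ≥ i2, ∀ n ≥ n2, ⨆ l, LinearMap.range (F.a l i n) = ⊤)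
    (hfin : Module.Finite A (F.E i2 n2)) :
    ∃ N, ∀ i ≥ N, ∀ n ≥ N, associatedPrimes A (F.E i n) = associatedPrimes A (F.E N N) := by
  have hg : (F.shift i2 n2).Gen := ⟨fun i n => hT _ (by omega) _ (by omega),
    fun i n => hA _ (by omega) _ (by omega), hfin⟩
  obtain ⟨N, hN⟩ := hg.stab
  have h' : ∀ i ≥ N, ∀ n ≥ N, associatedPrimes A (F.E (i2+i) (n2+n)) =
    associatedPrimes A (F.E (i2+N) (n2+N)) := hN
  refine ⟨i2 + n2 + N, fun i hi n hn => ?_⟩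
  obtain ⟨k, rfl⟩ := Nat.exists_eq_add_of_le (show i2 ≤ i by omega)
  obtain ⟨m, rfl⟩ := Nat.exists_eq_add_of_le (show n2 ≤ n by omega)
  rw [h' k (by omega) m (by omega)]
  have := h' (n2+N) (by omega) (i2+N) (by omega)
  rw [← this]
  have e1 : i2 + (n2+N) = i2+n2+N := by omega
  have e2 : n2 + (i2+N) = i2+n2+N := by omega
  rw [e1, e2]

/-- quotient of one stable subfamily by another -/
def quot (Z W : ∀ i n, Submodule A (F.E i n)) (hZ : F.Stable Z) (hW : F.Stable W) : Fam A c r where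
  E i n := Z i n ⧸ (W i n).comap (Z i n).subtype
  ag i n := inferInstance
  mod i n := inferInstance
  t l i n := Submodule.mapQ _ _ ((F.t l i n).restrict (hZ.1 l i n))
    (fun x hx => hW.1 l i n x.1 hx)
  a l i n := Submodule.mapQ _ _ ((F.a l i n).restrict (hZ.2 l i n))
    (fun x hx => hW.2 l i n x.1 hx)
  tt l k i n x := by
    obtain ⟨x, rfl⟩ := Submodule.mkQ_surjective _ x
    exact congrArg (Submodule.mkQ _) (Subtype.ext (F.tt l k i n x.1))
  aa l k i n x := by
    obtain ⟨x, rfl⟩ := Submodule.mkQ_surjective _ x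
    exact congrArg (Submodule.mkQ _) (Subtype.ext (F.aa l k i n x.1))
  ta l k i n x := by
    obtain ⟨x, rfl⟩ := Submodule.mkQ_surjective _ x
    exact congrArg (Submodule.mkQ _) (Subtype.ext (F.ta l k i n x.1))

theorem quot_gen {M N : Type} [AddCommGroup M] [AddCommGroup N] [Module A M] [Module A N]
    {k : ℕ} (u : Fin k → M →ₗ[A] N) (Z W : Submodule A M) (Z' W' : Submodule A N)
    (h : Z' = ⨆ l, Z.map (u l)) (hz : ∀ l, ∀ x ∈ Z, u l x ∈ Z')
    (hw : ∀ l, W.comap Z.subtype ≤ (W'.comap Z'.subtype).comap ((u l).restrict (hz l))) :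
    ⨆ l, LinearMap.range (Submodule.mapQ (W.comap Z.subtype) (W'.comap Z'.subtype)
      ((u l).restrict (hz l)) (hw l)) = ⊤ := by
  rw [eq_top_iff]
  rintro x -
  obtain ⟨⟨y, hy⟩, rfl⟩ := Submodule.mkQ_surjective _ x
  have key : Z' ≤ ((⨆ l, LinearMap.range (Submodule.mapQ (W.comap Z.subtype) (W'.comap Z'.subtype)
      ((u l).restrict (hz l)) (hw l))).comap (Submodule.mkQ _)).map Z'.subtype := by
    conv_lhs => rw [h]
    refine iSup_le fun l => ?_
    rintro _ ⟨x, hx, rfl⟩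
    refine ⟨⟨u l x, hz l x hx⟩, ?_, rfl⟩
    exact (le_iSup (fun l => LinearMap.range (Submodule.mapQ (W.comap Z.subtype)
      (W'.comap Z'.subtype) ((u l).restrict (hz l)) (hw l))) l) ⟨Submodule.mkQ _ ⟨x, hx⟩, rfl⟩
  obtain ⟨⟨w, hw'⟩, hw2, rfl⟩ := key hy
  exact hw2

theorem Gen.quot_stab [IsNoetherianRing A] {F : Fam A c r} (h : F.Gen)
    (hfin : ∀ i n, Module.Finite A (F.E i n))
    (Z W : ∀ i n, Submodule A (F.E i n)) (hZ : F.Stable Z) (hW : F.Stable W) :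
    ∃ N, ∀ i ≥ N, ∀ n ≥ N, associatedPrimes A (Z i n ⧸ (W i n).comap (Z i n).subtype) =
      associatedPrimes A (Z N N ⧸ (W N N).comap (Z N N).subtype) := by
  obtain ⟨i2, hi2⟩ := h.main.2.tgen hZ
  obtain ⟨n2, hn2⟩ := h.main.2.agen hZ
  refine (F.quot Z W hZ hW).stab_of_eventually (i2+1) (n2+1) ?_ ?_ ?_
  · intro i hi n hn
    exact quot_gen _ _ _ _ _ (hi2 i (by omega) n) _ (fun l x hx => hW.1 l i n x.1 hx)
  · intro i hi n hn
    exact quot_gen _ _ _ _ _ (hn2 n (by omega) i) _ (fun l x hx => hW.2 l i n x.1 hx)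
  · have := hfin (i2+1) (n2+1)
    change Module.Finite A (Z (i2+1) (n2+1) ⧸ (W (i2+1) (n2+1)).comap (Z (i2+1) (n2+1)).subtype)
    infer_instance

end Fam

-- Part 10

section app
variable {A : Type} [CommRing A]

theorem hom_finite [IsNoetherianRing A] (P N : Type) [AddCommGroup P] [Module A P]
    [AddCommGroup N] [Module A N] [Module.Finite A P] [Module.Finite A N] :
    Module.Finite A (P →ₗ[A] N) := by
  obtain ⟨k, g, hg⟩ := Module.Finite.exists_fin' A P
  refine Module.Finite.of_injective (LinearMap.lcomp A N g) ?_
  intro x y h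
  refine LinearMap.ext fun z => ?_
  obtain ⟨w, rfl⟩ := hg z
  exact LinearMap.congr_fun h w

/-- doubled degrees -/
def deg (e : ℕ) : ℕ → ℕ
  | 0 => e
  | i+1 => deg e i + 2

theorem deg_eq (e i : ℕ) : deg e i = e + 2 * i := by
  induction i with
  | zero => rfl
  | succ i ih => change deg e i + 2 = _; omega

variable (I : Ideal A) (D : Type) [AddCommGroup D] [Module A D]

abbrev ID (n : ℕ) : Submodule A D := I ^ n • (⊤ : Submodule A D)

def mulg (x : A) (hx : x ∈ I) (n : ℕ) : ↥(ID I D n) →ₗ[A] ↥(ID I D (n+1)) where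
  toFun y := ⟨x • y.1, by
    change x • y.1 ∈ I ^ (n+1) • (⊤ : Submodule A D)
    rw [pow_succ', mul_smul]
    exact Submodule.smul_mem_smul hx y.2⟩
  map_add' y z := Subtype.ext (smul_add _ _ _)
  map_smul' a y := Subtype.ext (smul_comm _ _ _)

theorem mulg_surj {r : ℕ} (g : Fin r → A) (hg : ∀ k, g k ∈ I) (hI : I ≤ Ideal.span (Set.range g))
    (n : ℕ) : Function.Surjective
      (∑ k, mulg I D (g k) (hg k) n ∘ₗ LinearMap.proj k : (Fin r → ↥(ID I D n)) →ₗ[A] _) := by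
  set u := (∑ k, mulg I D (g k) (hg k) n ∘ₗ LinearMap.proj k : (Fin r → ↥(ID I D n)) →ₗ[A] _)
    with hu
  have key : ID I D (n+1) ≤ (LinearMap.range u).map (ID I D (n+1)).subtype := by
    change I ^ (n+1) • (⊤ : Submodule A D) ≤ _
    rw [pow_succ', mul_smul, Submodule.smul_le]
    intro a ha x hx
    have h2 : Ideal.span (Set.range g) ≤ ((LinearMap.range u).map (ID I D (n+1)).subtype).comap
        (LinearMap.toSpanSingleton A D x) := by
      rw [Ideal.span, Submodule.span_le]
      rintro _ ⟨k, rfl⟩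
      refine ⟨mulg I D (g k) (hg k) n ⟨x, hx⟩, ⟨Pi.single k ⟨x, hx⟩, ?_⟩, rfl⟩
      rw [hu, LinearMap.sum_apply, Finset.sum_eq_single k]
      · simp
      · intro b _ hb
        simp [hb]
      · simp
    exact h2 (hI ha)
  rintro ⟨y, hy⟩
  obtain ⟨z, ⟨w, hw⟩, hz⟩ := key hy
  exact ⟨w, hw.trans (Subtype.ext hz)⟩

variable {M : Type} [AddCommGroup M] [Module A M] {c : ℕ}

/-- the family of cochains -/
def cochFam (C : OpRes A M c) (e : ℕ) {r : ℕ} (g : Fin r → A) (hg : ∀ k, g k ∈ I) : Fam A c r where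
  E i n := C.P (deg e i + 1) →ₗ[A] ↥(ID I D n)
  ag i n := inferInstance
  mod i n := inferInstance
  t l i n := LinearMap.lcomp A ↥(ID I D n) (C.t l (deg e i + 1))
  a k i n := LinearMap.compRight A (mulg I D (g k) (hg k) n)
  tt l k i n x := LinearMap.ext fun y =>
    congrArg x (LinearMap.congr_fun (C.tt k l (deg e i + 1)) y)
  aa l k i n x := LinearMap.ext fun y => Subtype.ext (smul_comm (g l) (g k) (x y).1)
  ta l k i n x := rfl

theorem cochFam_gen [IsNoetherianRing A] [Module.Finite A D] (C : OpRes A M c) (e : ℕ)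
    (he : C.i1 ≤ e) {r : ℕ} (g : Fin r → A)
    (hg : ∀ k, g k ∈ I) (hI : I ≤ Ideal.span (Set.range g)) : (cochFam I D C e g hg).Gen := by
  refine ⟨fun i n => ?_, fun i n => ?_, ?_⟩
  · rw [eq_top_iff]
    rintro (x : C.P (deg e i + 1 + 2) →ₗ[A] ↥(ID I D n)) -
    have hx : x = ∑ l, (x ∘ₗ C.s l (deg e i + 1)) ∘ₗ C.t l (deg e i + 1) := by
      have := C.st (deg e i + 1) (by have := deg_eq e i; omega)
      refine LinearMap.ext fun y => ?_
      have h2 := congrArg x (LinearMap.congr_fun this y)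
      simp only [LinearMap.sum_apply, map_sum, LinearMap.id_apply, LinearMap.comp_apply] at h2 ⊢
      exact h2.symm
    rw [hx]
    refine Submodule.sum_mem _ fun l _ => ?_
    exact (le_iSup (fun l => LinearMap.range ((cochFam I D C e g hg).t l i n)) l)
      ⟨x ∘ₗ C.s l (deg e i + 1), rfl⟩
  · rw [eq_top_iff]
    rintro (x : C.P (deg e i + 1) →ₗ[A] ↥(ID I D (n+1))) -
    obtain ⟨w, hw⟩ := Module.projective_lifting_property _ x (mulg_surj I D g hg hI n)
    have hx : x = ∑ l, mulg I D (g l) (hg l) n ∘ₗ (LinearMap.proj l ∘ₗ w) := by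
      rw [← hw]
      refine LinearMap.ext fun y => ?_
      simp only [LinearMap.sum_apply, LinearMap.comp_apply]
    rw [hx]
    refine Submodule.sum_mem _ fun l _ => ?_
    exact (le_iSup (fun l => LinearMap.range ((cochFam I D C e g hg).a l i n)) l)
      ⟨LinearMap.proj l ∘ₗ w, rfl⟩
  · have := hom_finite (A := A) (C.P (e + 1)) ↥(ID I D 0)
    exact this

def Zc (C : OpRes A M c) (N : Type) [AddCommGroup N] [Module A N] (q : ℕ) :
    Submodule A (C.P (q+1) →ₗ[A] N) := LinearMap.ker (C.pre N (q+1))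

def Wc (C : OpRes A M c) (N : Type) [AddCommGroup N] [Module A N] (q : ℕ) :
    Submodule A (C.P (q+1) →ₗ[A] N) := LinearMap.range (C.pre N q)

theorem mem_Zc (C : OpRes A M c) (N : Type) [AddCommGroup N] [Module A N] (q : ℕ)
    (x : C.P (q+1) →ₗ[A] N) : x ∈ Zc C N q ↔ x ∘ₗ C.d (q+1) = 0 := LinearMap.mem_ker

theorem ass_ext (C : OpRes A M c) (N : Type) [AddCommGroup N] [Module A N] (q : ℕ) :
    associatedPrimes A (extAP A M N (q+1)) =
      associatedPrimes A (Zc C N q ⧸ (Wc C N q).comap (Zc C N q).subtype) := by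
  obtain ⟨φ⟩ := C.extEq N q
  exact LinearEquiv.AssociatedPrimes.eq φ

theorem ext_stab_aux [IsNoetherianRing A] [Module.Finite A D] (C : OpRes A M c) (e : ℕ)
    (he : C.i1 ≤ e) : ∃ N, ∀ i ≥ N, ∀ n ≥ N,
      associatedPrimes A (extAP A M ↥(ID I D n) (e + 2 * i + 1)) =
      associatedPrimes A (extAP A M ↥(ID I D N) (e + 2 * N + 1)) := by
  obtain ⟨r, g, hg⟩ := Submodule.fg_iff_exists_fin_generating_family.1
    ((isNoetherianRing_iff_ideal_fg A).1 inferInstance I)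
  have hgm : ∀ k, g k ∈ I := fun k => hg ▸ Submodule.subset_span ⟨k, rfl⟩
  have hgen := cochFam_gen I D C e he g hgm hg.ge
  have hfin : ∀ i n, Module.Finite A ((cochFam I D C e g hgm).E i n) := by
    intro i n
    have := hom_finite (A := A) (C.P (deg e i + 1)) ↥(ID I D n)
    exact this
  obtain ⟨N, hN⟩ := hgen.quot_stab hfin
    (fun i n => Zc C ↥(ID I D n) (deg e i))
    (fun i n => Wc C ↥(ID I D n) (deg e i))
    (by
      constructor
      · intro l i n (x : C.P (deg e i + 1) →ₗ[A] ↥(ID I D n)) hx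
        refine LinearMap.ext fun y => ?_
        have h1 := congrArg x (LinearMap.congr_fun (C.td l (deg e i + 1)) y)
        have h2 := LinearMap.congr_fun ((mem_Zc C _ _ x).1 hx) (C.t l (deg e i + 2) y)
        exact h1.symm.trans h2
      · intro l i n (x : C.P (deg e i + 1) →ₗ[A] ↥(ID I D n)) hx
        refine LinearMap.ext fun y => ?_
        have h2 := LinearMap.congr_fun ((mem_Zc C _ _ x).1 hx) y
        exact (congrArg (mulg I D (g l) (hgm l) n) h2).trans (map_zero _))
    (by
      constructor
      · rintro l i n _ ⟨x, rfl⟩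
        refine ⟨x ∘ₗ C.t l (deg e i), ?_⟩
        refine LinearMap.ext fun y => ?_
        exact (congrArg x (LinearMap.congr_fun (C.td l (deg e i)) y)).symm
      · rintro l i n _ ⟨x, rfl⟩
        exact ⟨mulg I D (g l) (hgm l) n ∘ₗ x, rfl⟩)
  refine ⟨N, fun i hi n hn => ?_⟩
  rw [← deg_eq, ← deg_eq, ass_ext, ass_ext]
  exact hN i hi n hn

theorem ext_stab [IsNoetherianRing A] [Module.Finite A D] (C : OpRes A M c) :
    ∃ i₀ n₀ : ℕ, ∀ i ≥ i₀, ∀ n ≥ n₀,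
      associatedPrimes A (extAP A M (↥(I ^ n • (⊤ : Submodule A D))) (2 * i)) =
        associatedPrimes A (extAP A M (↥(I ^ n₀ • (⊤ : Submodule A D))) (2 * i₀)) ∧
      associatedPrimes A (extAP A M (↥(I ^ n • (⊤ : Submodule A D))) (2 * i + 1)) =
        associatedPrimes A (extAP A M (↥(I ^ n₀ • (⊤ : Submodule A D))) (2 * i₀ + 1)) := by
  obtain ⟨N1, h1⟩ := ext_stab_aux I D C (2 * C.i1 + 1) (by omega)
  obtain ⟨N2, h2⟩ := ext_stab_aux I D C (2 * C.i1) (by omega)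
  have k1 : ∀ i ≥ C.i1 + 1 + N1, ∀ n ≥ N1, associatedPrimes A (extAP A M ↥(ID I D n) (2 * i)) =
      associatedPrimes A (extAP A M ↥(ID I D N1) (2 * C.i1 + 1 + 2 * N1 + 1)) := by
    intro i hi n hn
    rw [← h1 (i - C.i1 - 1) (by omega) n hn]
    rw [show 2 * C.i1 + 1 + 2 * (i - C.i1 - 1) + 1 = 2 * i by omega]
  have k2 : ∀ i ≥ C.i1 + N2, ∀ n ≥ N2, associatedPrimes A (extAP A M ↥(ID I D n) (2 * i + 1)) =
      associatedPrimes A (extAP A M ↥(ID I D N2) (2 * C.i1 + 2 * N2 + 1)) := by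
    intro i hi n hn
    rw [← h2 (i - C.i1) (by omega) n hn]
    rw [show 2 * C.i1 + 2 * (i - C.i1) + 1 = 2 * i + 1 by omega]
  refine ⟨C.i1 + 1 + N1 + N2, N1 + N2, fun i hi n hn => ⟨?_, ?_⟩⟩
  · exact (k1 i (by omega) n (by omega)).trans (k1 _ (by omega) _ (by omega)).symm
  · exact (k2 i (by omega) n (by omega)).trans (k2 _ (by omega) _ (by omega)).symm

end app

-- Part 11

theorem ofList_take (Q : Type) [CommRing Q] (c : ℕ) (f : Fin c → Q) (f' : ℕ → Q)
    (hf' : ∀ i : Fin c, f' i = f i) (j : ℕ) (hj : j ≤ c) :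
    Ideal.ofList ((List.ofFn f).take j) = Jd f' j := by
  unfold Ideal.ofList Jd
  congr 1
  ext x
  constructor
  · intro hx
    obtain ⟨i, hi, rfl⟩ := List.mem_take_iff_getElem.1 hx
    have hi' : i < j ∧ i < c := by simpa using hi
    exact ⟨i, hi'.1, by rw [List.getElem_ofFn]; exact hf' ⟨i, hi'.2⟩⟩
  · rintro ⟨i, hi, rfl⟩
    have hi1 : i < j := hi
    refine List.mem_take_iff_getElem.2 ⟨i, by simp; omega, ?_⟩
    rw [List.getElem_ofFn]; exact (hf' ⟨i, by omega⟩).symm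

/-- With `Q` Noetherian of finite Krull dimension, `f_1,…,f_c` a regular
sequence, `A = Q/(f)`, `M` a finitely generated `A`-module of finite projective dimension over
`Q`, `I` an ideal and `D` a finitely generated `A`-module: there exist `i₀, n₀` such that for
all `i ≥ i₀`, `n ≥ n₀`, `Ass_A Ext^{2i}_A(M, IⁿD) = Ass_A Ext^{2i₀}_A(M, I^{n₀}D)` and
`Ass_A Ext^{2i+1}_A(M, IⁿD) = Ass_A Ext^{2i₀+1}_A(M, I^{n₀}D)`. -/
theorem stmt7 (Q : Type) [CommRing Q] [IsNoetherianRing Q]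
    (hdim : ringKrullDim Q < ⊤)
    (c : ℕ) (f : Fin c → Q) (hreg : RingTheory.Sequence.IsRegular Q (List.ofFn f))
    (A : Type) [CommRing A] [Algebra Q A]
    (hsurj : Function.Surjective (algebraMap Q A))
    (hker : RingHom.ker (algebraMap Q A) = Ideal.span (Set.range f))
    (M : Type) [AddCommGroup M] [Module A M] [Module Q M] [IsScalarTower Q A M]
    [Module.Finite A M]
    -- `M` has finite projective dimension over `Q`:
    (hproj : ∃ n : ℕ, ∀ (L : Type) [AddCommGroup L] [Module Q L], ∀ i : ℕ, n < i →
      Subsingleton (extAP Q M L i))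
    (I : Ideal A) (D : Type) [AddCommGroup D] [Module A D] [Module.Finite A D] :
    ∃ i₀ n₀ : ℕ, ∀ i ≥ i₀, ∀ n ≥ n₀,
      associatedPrimes A (extAP A M (↥(I ^ n • (⊤ : Submodule A D))) (2 * i)) =
        associatedPrimes A (extAP A M (↥(I ^ n₀ • (⊤ : Submodule A D))) (2 * i₀)) ∧
      associatedPrimes A (extAP A M (↥(I ^ n • (⊤ : Submodule A D))) (2 * i + 1)) =
        associatedPrimes A (extAP A M (↥(I ^ n₀ • (⊤ : Submodule A D))) (2 * i₀ + 1)) := by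
  have hAN : IsNoetherianRing A := isNoetherianRing_of_surjective Q A (algebraMap Q A) hsurj
  have hQA : Module.Finite Q A := Module.Finite.of_surjective (Algebra.linearMap Q A) hsurj
  have hQM : Module.Finite Q M := Module.Finite.trans A M
  let f' : ℕ → Q := fun i => if h : i < c then f ⟨i, h⟩ else 0
  have hf' : ∀ i : Fin c, f' i = f i := fun i => dif_pos i.2
  have hJ : Ideal.span (Set.range f) = Jd f' c := by
    unfold Jd
    congr 1
    ext x
    constructor
    · rintro ⟨i, rfl⟩
      exact ⟨i, i.2, hf' i⟩
    · rintro ⟨i, hi, rfl⟩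
      exact ⟨⟨i, hi⟩, (hf' ⟨i, hi⟩).symm⟩
  obtain ⟨n, hn⟩ := hproj
  obtain ⟨m, hm⟩ := pd_of_ext (R := Q) (M := M) n hn
  have hM : ∀ k < c, ∀ x : M, f' k • x = 0 := by
    intro k hk x
    have : f ⟨k, hk⟩ ∈ RingHom.ker (algebraMap Q A) := by
      rw [hker]; exact Ideal.subset_span ⟨_, rfl⟩
    rw [hf' ⟨k, hk⟩, ← algebraMap_smul A, (RingHom.mem_ker).1 this, zero_smul]
  have hf : ∀ j < c, ∀ y, f' j * y ∈ Jd f' j → y ∈ Jd f' j := by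
    intro j hj y hy
    have h := hreg.toIsWeaklyRegular.regular_mod_prev j (by simpa using hj)
    rw [ofList_take Q c f f' hf' j hj.le, List.getElem_ofFn, ← hf' ⟨j, hj⟩] at h
    have e : (Jd f' j • (⊤ : Submodule Q Q)) = Jd f' j := by
      rw [smul_eq_mul, Ideal.mul_top]
    rw [← e]
    refine (isSMulRegular_on_quot_iff_lsmul_comap_le _ _).1 h ?_
    rw [e]
    exact hy
  obtain ⟨S⟩ := Stage.exists_final (f := f') (c := c) (M := M) m hm hM hf
  exact ext_stab I D (S.toOpRes hsurj (hker.trans hJ))
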